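/- Let P = U ⊕ U be the orthogonal sum of two hyperbolic planes, where U is the integral lattice with basis u, v and form u² = v² = 0, u·v = 1. Then: (i) for every isometry t of P with t³ = id and t ≠ id, the fixed sublattice P^t = {x ∈ P : t x = x} is isometric to exactly one of: the lattice A₂ with Gram matrix [[−2, 1], [1, −2]], the lattice A₂(−1) with Gram matrix [[2, −1], [−1, 2]], or the zero lattice, and all three cases occur; (ii) any two order-3 isometries of P with isometric fixed sublattices generate subgroups of Aut P that are conjugate in Aut P; (iii) if t is an order-3 isometry of P with P^t = 0 and s is an isometry of P with s² = id and s t s = t⁻¹, then the fixed sublattice P^s is isometric either to U(2) (Gram matrix [[0, 2], [2, 0]]) or to the lattice with Gram matrix diag(2, −2), and both cases occur. -/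

import Mathlib

/-- The lattice `P = U ⊕ U`: the orthogonal sum of two hyperbolic planes,
with basis `u₁ = ((1,0),(0,0))`, `v₁ = ((0,1),(0,0))`, `u₂ = ((0,0),(1,0))`,
`v₂ = ((0,0),(0,1))`. -/
abbrev HypSum : Type := (ℤ × ℤ) × (ℤ × ℤ)

/-- The bilinear form of `U ⊕ U`. -/
def hypB (x y : HypSum) : ℤ :=
  x.1.1 * y.1.2 + x.1.2 * y.1.1 + x.2.1 * y.2.2 + x.2.2 * y.2.1

/-- The fixed sublattice of an automorphism `t` of `U ⊕ U`. -/
def fixLat (t : HypSum ≃ₗ[ℤ] HypSum) : Submodule ℤ HypSum :=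
  LinearMap.ker (t.toLinearMap - LinearMap.id)

/-- `S` admits a generating pair with prescribed Gram matrix `[[a, c], [c, b]]`;
for the (nondegenerate) Gram matrices used below this says precisely that `S` is
isometric to the rank-2 lattice with this Gram matrix. -/
def HasGram (S : Submodule ℤ HypSum) (a b c : ℤ) : Prop :=
  ∃ u v : HypSum, u ∈ S ∧ v ∈ S ∧
    hypB u u = a ∧ hypB v v = b ∧ hypB u v = c ∧
    Submodule.span ℤ ({u, v} : Set HypSum) = S

/-- `t` is an isometry of `U ⊕ U`. -/
def IsIsom (t : HypSum ≃ₗ[ℤ] HypSum) : Prop :=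
  ∀ x y : HypSum, hypB (t x) (t y) = hypB x y


set_option linter.unusedSimpArgs false
namespace H13

lemma hB_comm (x y : HypSum) : hypB x y = hypB y x := by simp only [hypB]; ring
lemma hB_add_left (x y z : HypSum) : hypB (x + y) z = hypB x z + hypB y z := by
  simp only [hypB, Prod.fst_add, Prod.snd_add]; ring
lemma hB_add_right (x y z : HypSum) : hypB x (y + z) = hypB x y + hypB x z := by
  simp only [hypB, Prod.fst_add, Prod.snd_add]; ring
lemma hB_sub_left (x y z : HypSum) : hypB (x - y) z = hypB x z - hypB y z := by
  simp only [hypB, Prod.fst_sub, Prod.snd_sub]; ring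
lemma hB_sub_right (x y z : HypSum) : hypB x (y - z) = hypB x y - hypB x z := by
  simp only [hypB, Prod.fst_sub, Prod.snd_sub]; ring
lemma hB_neg_left (x y : HypSum) : hypB (-x) y = -hypB x y := by
  simp only [hypB, Prod.fst_neg, Prod.snd_neg]; ring
lemma hB_neg_right (x y : HypSum) : hypB x (-y) = -hypB x y := by
  simp only [hypB, Prod.fst_neg, Prod.snd_neg]; ring
lemma hB_smul_left (k : ℤ) (x y : HypSum) : hypB (k • x) y = k * hypB x y := by
  simp only [hypB, Prod.smul_fst, Prod.smul_snd, smul_eq_mul]; ring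
lemma hB_smul_right (k : ℤ) (x y : HypSum) : hypB x (k • y) = k * hypB x y := by
  simp only [hypB, Prod.smul_fst, Prod.smul_snd, smul_eq_mul]; ring
lemma hB_zero_left (x : HypSum) : hypB 0 x = 0 := by simp [hypB]
lemma hB_zero_right (x : HypSum) : hypB x 0 = 0 := by simp [hypB]

lemma hB_even (x : HypSum) : ∃ a, hypB x x = 2 * a :=
  ⟨x.1.1 * x.1.2 + x.2.1 * x.2.2, by simp only [hypB]; ring⟩

lemma hB_nondeg (x x' : HypSum) (h : ∀ y, hypB x y = hypB x' y) : x = x' := by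
  have h1 := h ((1, 0), (0, 0))
  have h2 := h ((0, 1), (0, 0))
  have h3 := h ((0, 0), (1, 0))
  have h4 := h ((0, 0), (0, 1))
  simp [hypB] at h1 h2 h3 h4
  ext <;> assumption

/-- `S` has generators `u, v` with dual vectors `y, z`. -/
def Dual2 (S : Submodule ℤ HypSum) (u v y z : HypSum) : Prop :=
  (∀ x, x ∈ S ↔ ∃ a b : ℤ, x = a • u + b • v) ∧
    hypB u y = 1 ∧ hypB u z = 0 ∧ hypB v y = 0 ∧ hypB v z = 1

lemma dual_exists (φ : HypSum →ₗ[ℤ] HypSum) (f : LinearMap.ker φ →ₗ[ℤ] ℤ) :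
    ∃ y, ∀ x (hx : x ∈ LinearMap.ker φ), hypB x y = f ⟨x, hx⟩ := by
  obtain ⟨σ, hσ⟩ := Module.projective_lifting_property φ.rangeRestrict LinearMap.id
    φ.surjective_rangeRestrict
  have hσ' : ∀ w, φ.rangeRestrict (σ w) = w := fun w => by
    exact LinearMap.congr_fun hσ w
  let r : HypSum →ₗ[ℤ] LinearMap.ker φ :=
    LinearMap.codRestrict _ (LinearMap.id - σ ∘ₗ φ.rangeRestrict) (fun c => by
      have := congrArg Subtype.val (hσ' (φ.rangeRestrict c))
      simp only [LinearMap.mem_ker, LinearMap.sub_apply, LinearMap.id_apply, LinearMap.comp_apply,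
        map_sub, sub_eq_zero]
      simpa using this.symm)
  have hr : ∀ x (hx : x ∈ LinearMap.ker φ), r x = ⟨x, hx⟩ := by
    intro x hx
    have h0 : φ.rangeRestrict x = 0 := by
      ext1
      simpa using hx
    ext1
    simp [r, h0]
  let g : HypSum →ₗ[ℤ] ℤ := f ∘ₗ r
  refine ⟨((g ((0, 1), (0, 0)), g ((1, 0), (0, 0))), (g ((0, 0), (0, 1)), g ((0, 0), (1, 0)))), ?_⟩
  intro x hx
  have hg : g x = f ⟨x, hx⟩ := by
    simp only [g, LinearMap.comp_apply, hr x hx]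
  rw [← hg]
  have hx' : x = x.1.1 • ((1, 0), (0, 0)) + x.1.2 • ((0, 1), (0, 0)) + x.2.1 • ((0, 0), (1, 0))
      + x.2.2 • (((0, 0), (0, 1)) : HypSum) := by
    ext <;> simp
  conv_rhs => rw [hx']
  simp only [map_add, map_smul, smul_eq_mul, hypB]

lemma ker_pair (φ : HypSum →ₗ[ℤ] HypSum) (h : Module.finrank ℤ (LinearMap.ker φ) = 2) :
    ∃ u v y z, Dual2 (LinearMap.ker φ) u v y z := by
  let b : Module.Basis (Fin 2) ℤ (LinearMap.ker φ) := Module.finBasisOfFinrankEq _ _ h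
  obtain ⟨y, hy⟩ := dual_exists φ (b.coord 0)
  obtain ⟨z, hz⟩ := dual_exists φ (b.coord 1)
  refine ⟨b 0, b 1, y, z, ?_, ?_, ?_, ?_, ?_⟩
  · intro x
    constructor
    · intro hx
      have := b.sum_repr ⟨x, hx⟩
      rw [Fin.sum_univ_two] at this
      have := congrArg Subtype.val this
      exact ⟨_, _, by simpa using this.symm⟩
    · rintro ⟨p, q, rfl⟩
      exact Submodule.add_mem _ (Submodule.smul_mem _ _ (b 0).2) (Submodule.smul_mem _ _ (b 1).2)
  · rw [hy _ (b 0).2]; simp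
  · rw [hz _ (b 0).2]; simp
  · rw [hy _ (b 1).2]; simp
  · rw [hz _ (b 1).2]; simp

lemma Dual2.gram {S u v y z} (h : Dual2 S u v y z) {a b c : ℤ} (ha : hypB u u = a)
    (hb : hypB v v = b) (hc : hypB u v = c) : HasGram S a b c := by
  refine ⟨u, v, (h.1 u).2 ⟨1, 0, by simp⟩, (h.1 v).2 ⟨0, 1, by simp⟩, ha, hb, hc, ?_⟩
  ext x
  rw [Submodule.mem_span_pair, h.1]
  constructor <;> rintro ⟨p, q, e⟩ <;> exact ⟨p, q, e.symm⟩

lemma Dual2.swap {S u v y z} (h : Dual2 S u v y z) : Dual2 S v u z y := by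
  obtain ⟨h0, h1, h2, h3, h4⟩ := h
  refine ⟨fun x => (h0 x).trans ?_, h4, h3, h2, h1⟩
  constructor <;> rintro ⟨p, q, rfl⟩ <;> exact ⟨q, p, add_comm _ _⟩

lemma Dual2.neg {S u v y z} (h : Dual2 S u v y z) : Dual2 S u (-v) y (-z) := by
  obtain ⟨h0, h1, h2, h3, h4⟩ := h
  refine ⟨fun x => (h0 x).trans ?_, h1, ?_, ?_, ?_⟩
  · constructor <;> rintro ⟨p, q, rfl⟩ <;> exact ⟨p, -q, by simp⟩
  all_goals simp [hB_neg_left, hB_neg_right, *]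

lemma Dual2.shear {S u v y z} (k : ℤ) (h : Dual2 S u v y z) :
    Dual2 S u (v + k • u) (y - k • z) z := by
  obtain ⟨h0, h1, h2, h3, h4⟩ := h
  refine ⟨fun x => (h0 x).trans ?_, ?_, ?_, ?_, ?_⟩
  · constructor
    · rintro ⟨p, q, rfl⟩; exact ⟨p - k * q, q, by module⟩
    · rintro ⟨p, q, rfl⟩; exact ⟨p + k * q, q, by module⟩
  all_goals simp only [hB_add_left, hB_sub_right, hB_smul_left, hB_smul_right, h1, h2, h3, h4]
  all_goals ring

lemma red3 (n : ℕ) : ∀ (S : Submodule ℤ HypSum) (u v y z : HypSum) (a b c : ℤ),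
    Dual2 S u v y z → hypB u u = 2 * a → hypB v v = 2 * c → hypB u v = b →
    4 * a * c - b ^ 2 = 3 → b.natAbs ≤ n →
    ∃ u v y z, ∃ ε : ℤ, (ε = 1 ∨ ε = -1) ∧ Dual2 S u v y z ∧ hypB u u = 2 * ε ∧
      hypB v v = 2 * ε ∧ hypB u v = -ε := by
  induction n with
  | zero =>
    intro S u v y z a b c h _ _ _ hD hb
    have : b = 0 := by omega
    subst this
    ring_nf at hD
    omega
  | succ n ih =>
    intro S u v y z a b c h hu hv huv hD hb
    have hodd : b % 2 = 1 := by
      rcases Int.emod_two_eq_zero_or_one b with h' | h'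
      · exfalso
        obtain ⟨k, rfl⟩ := Int.dvd_of_emod_eq_zero h'
        have : 4 * (a * c - k ^ 2) = 3 := by linarith
        omega
      · exact h'
    by_cases h1 : b.natAbs ≤ 1
    · have hb2 : b = 1 ∨ b = -1 := by omega
      have hac : a * c = 1 := by rcases hb2 with rfl | rfl <;> linarith
      have hac' : (a = 1 ∧ c = 1) ∨ (a = -1 ∧ c = -1) := Int.mul_eq_one_iff_eq_one_or_neg_one.1 hac
      have ha : a = 1 ∨ a = -1 := by omega
      have hca : c = a := by omega
      by_cases hba : b = -a
      · exact ⟨u, v, y, z, a, ha, h, hu, by rw [hv, hca], by rw [huv, hba]⟩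
      · refine ⟨u, -v, y, -z, a, ha, h.neg, hu, ?_, ?_⟩
        · rw [hB_neg_left, hB_neg_right, hv, hca]; ring
        · rw [hB_neg_right, huv]; omega
    · -- reduce
      have key : ∀ (u v y z : HypSum) (a c : ℤ), Dual2 S u v y z → hypB u u = 2 * a →
          hypB v v = 2 * c → hypB u v = b → 4 * a * c - b ^ 2 = 3 → |a| ≤ |c| →
          ∃ u v y z, ∃ ε : ℤ, (ε = 1 ∨ ε = -1) ∧ Dual2 S u v y z ∧ hypB u u = 2 * ε ∧
            hypB v v = 2 * ε ∧ hypB u v = -ε := by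
        intro u v y z a c h hu hv huv hD hle
        have ha0 : a ≠ 0 := by rintro rfl; nlinarith
        have hab : |a| < |b| := by
          by_contra hcon
          push Not at hcon
          have h3 : |a| * |c| = a * c := by
            rw [← abs_mul, abs_of_nonneg]; nlinarith [sq_nonneg b]
          have h4 : |b| ≥ 2 := by rw [Int.abs_eq_natAbs]; omega
          nlinarith [sq_abs b, abs_nonneg a]
        have hk : ∃ k : ℤ, (b + k * (2 * a)).natAbs ≤ n := by
          have : (b + 2 * a).natAbs ≤ n ∨ (b - 2 * a).natAbs ≤ n := by
            rw [Int.abs_eq_natAbs, Int.abs_eq_natAbs] at hab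
            omega
          rcases this with h' | h'
          · exact ⟨1, by rwa [one_mul]⟩
          · exact ⟨-1, by convert h' using 2; ring⟩
        obtain ⟨k, hk⟩ := hk
        refine ih S u (v + k • u) (y - k • z) z a (b + k * (2 * a)) (c + k * b + k ^ 2 * a)
          (h.shear k) hu ?_ ?_ ?_ hk
        · simp only [hB_add_left, hB_add_right, hB_smul_left, hB_smul_right, hB_comm v u, hu, hv, huv]
          ring
        · simp only [hB_add_left, hB_add_right, hB_smul_left, hB_smul_right, hB_comm v u, hu, hv, huv]
        · linear_combination hD
      rcases le_total |a| |c| with hle | hle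
      · exact key u v y z a c h hu hv huv hD hle
      · exact key v u z y c a h.swap hv hu (by rw [hB_comm, huv]) (by linarith) hle

lemma red1 (n : ℕ) : ∀ (S : Submodule ℤ HypSum) (u v y z : HypSum) (a b c : ℤ),
    Dual2 S u v y z → hypB u u = 2 * a → hypB v v = 2 * c → hypB u v = 2 * b →
    a * c - b ^ 2 = -1 → b.natAbs ≤ n →
    HasGram S 0 0 2 ∨ HasGram S 2 (-2) 0 := by
  -- the isotropic case
  have key0 : ∀ (S : Submodule ℤ HypSum) (u v y z : HypSum) (b c : ℤ),
    Dual2 S u v y z → hypB u u = 0 → hypB v v = 2 * c → hypB u v = 2 * b → b ^ 2 = 1 →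
    HasGram S 0 0 2 ∨ HasGram S 2 (-2) 0 := by
    have key1 : ∀ (S : Submodule ℤ HypSum) (u v y z : HypSum) (c : ℤ),
      Dual2 S u v y z → hypB u u = 0 → hypB v v = 2 * c → hypB u v = 2 →
      HasGram S 0 0 2 ∨ HasGram S 2 (-2) 0 := by
      intro S u v y z c h hu hv huv
      rcases Int.even_or_odd' c with ⟨k, rfl | rfl⟩
      · left
        refine (h.shear (-k)).gram hu ?_ ?_ <;>
          simp only [hB_add_left, hB_add_right, hB_smul_left, hB_smul_right, hB_comm v u, hu, hv, huv] <;>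
          ring
      · right
        refine ((h.shear (-k)).swap.shear (-1)).gram ?_ ?_ ?_ <;>
          simp only [hB_add_left, hB_add_right, hB_smul_left, hB_smul_right, hB_comm v u, hu, hv, huv] <;>
          ring
    intro S u v y z b c h hu hv huv hb
    rcases (show b = 1 ∨ b = -1 from by simpa using hb) with rfl | rfl
    · exact key1 S u v y z c h hu hv huv
    · exact key1 S u (-v) y (-z) c h.neg hu (by rw [hB_neg_left, hB_neg_right, hv]; ring)
        (by rw [hB_neg_right, huv]; ring)
  induction n with
  | zero =>
    intro S u v y z a b c h hu hv huv hD hb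
    have : b = 0 := by omega
    subst this
    have hac : a * (-c) = 1 := by linarith
    right
    rcases Int.mul_eq_one_iff_eq_one_or_neg_one.1 hac with ⟨h1, h2⟩ | ⟨h1, h2⟩
    · exact h.gram (by omega) (by omega) (by omega)
    · exact h.swap.gram (by omega) (by omega) (by rw [hB_comm]; omega)
  | succ n ih =>
    intro S u v y z a b c h hu hv huv hD hb
    have key : ∀ (u v y z : HypSum) (a c : ℤ), Dual2 S u v y z → hypB u u = 2 * a →
          hypB v v = 2 * c → hypB u v = 2 * b → a * c - b ^ 2 = -1 → |a| ≤ |c| →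
          HasGram S 0 0 2 ∨ HasGram S 2 (-2) 0 := by
      intro u v y z a c h hu hv huv hD hle
      by_cases ha0 : a = 0
      · subst ha0
        exact key0 S u v y z b c h (by linarith) hv huv (by linarith)
      by_cases hb0 : b = 0
      · exact ih S u v y z a b c h hu hv huv hD (by omega)
      have hab : |a| ≤ |b| := by
        by_contra hcon
        push Not at hcon
        have h3 : |a| * |c| = a * c := by
          rw [← abs_mul, abs_of_nonneg]
          have : b ^ 2 > 0 := by positivity
          linarith
        nlinarith [sq_abs b, abs_nonneg a, abs_nonneg b]
      have hk : ∃ k : ℤ, (b + k * a).natAbs ≤ n := by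
        have : (b + a).natAbs ≤ n ∨ (b - a).natAbs ≤ n := by
          rw [Int.abs_eq_natAbs, Int.abs_eq_natAbs] at hab
          omega
        rcases this with h' | h'
        · exact ⟨1, by rwa [one_mul]⟩
        · exact ⟨-1, by convert h' using 2; ring⟩
      obtain ⟨k, hk⟩ := hk
      refine ih S u (v + k • u) (y - k • z) z a (b + k * a) (c + 2 * k * b + k ^ 2 * a)
        (h.shear k) hu ?_ ?_ ?_ hk
      · simp only [hB_add_left, hB_add_right, hB_smul_left, hB_smul_right, hB_comm v u, hu, hv, huv]
        ring
      · simp only [hB_add_left, hB_add_right, hB_smul_left, hB_smul_right, hB_comm v u, hu, hv, huv]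
        ring
      · linear_combination hD
    rcases le_total |a| |c| with hle | hle
    · exact key u v y z a c h hu hv huv hD hle
    · exact key v u z y c a h.swap hv hu (by rw [hB_comm, huv]) (by linarith) hle


lemma finrank_hyp : Module.finrank ℤ HypSum = 4 := by simp [Module.finrank_prod]

lemma fr_le (S T : Submodule ℤ HypSum) (f g : HypSum →ₗ[ℤ] HypSum) (hf : ∀ x, f x ∈ S)
    (hg : ∀ x, g x ∈ T) (inj : ∀ x, f x = 0 → g x = 0 → x = 0) :
    4 ≤ Module.finrank ℤ S + Module.finrank ℤ T := by
  have := LinearMap.finrank_le_finrank_of_injective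
    (f := LinearMap.prod (LinearMap.codRestrict S f hf) (LinearMap.codRestrict T g hg)) (by
      rw [← LinearMap.ker_eq_bot, LinearMap.ker_eq_bot']
      intro x hx
      exact inj x (congrArg (fun w => (w.1 : HypSum)) hx) (congrArg (fun w => (w.2 : HypSum)) hx))
  rwa [finrank_hyp, Module.finrank_prod] at this

lemma fr_ge (S T : Submodule ℤ HypSum) (g : HypSum →ₗ[ℤ] HypSum)
    (inj : ∀ a ∈ S, ∀ b ∈ T, a + g b = 0 → a = 0 ∧ b = 0) :
    Module.finrank ℤ S + Module.finrank ℤ T ≤ 4 := by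
  have := LinearMap.finrank_le_finrank_of_injective
    (f := LinearMap.coprod S.subtype (g ∘ₗ T.subtype)) (by
      rw [← LinearMap.ker_eq_bot, LinearMap.ker_eq_bot']
      rintro ⟨a, b⟩ hx
      simp only [LinearMap.coprod_apply, LinearMap.comp_apply, Submodule.subtype_apply] at hx
      have := inj a a.2 b b.2 hx
      ext1 <;> ext1
      · exact this.1
      · exact this.2)
  rwa [finrank_hyp, Module.finrank_prod] at this

lemma mem_fix (t : HypSum ≃ₗ[ℤ] HypSum) (x : HypSum) : x ∈ fixLat t ↔ t x = x := by
  simp [fixLat, sub_eq_zero]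

lemma smul_zero_hyp {k : ℤ} (hk : k ≠ 0) {x : HypSum} (h : k • x = 0) : x = 0 :=
  (smul_eq_zero.1 h).resolve_left hk

lemma Dual2.zero {S u v y z} (h : Dual2 S u v y z) {p q p' q' : ℤ}
    (e : p • u + q • v = p' • u + q' • v) : p = p' ∧ q = q' := by
  have e1 := congrArg (fun x => hypB x y) e
  have e2 := congrArg (fun x => hypB x z) e
  simp only [hB_add_left, hB_smul_left, h.2.1, h.2.2.1, h.2.2.2.1, h.2.2.2.2] at e1 e2
  constructor <;> linarith

theorem part3 (t s : HypSum ≃ₗ[ℤ] HypSum) (h3 : ∀ x, t (t (t x)) = x)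
    (h0 : ∀ x, x + t x + t (t x) = 0) (ht : IsIsom t)
    (hs : IsIsom s) (hs2 : ∀ x, s (s x) = x) (hst : ∀ x, s (t x) = t (t (s x))) :
    HasGram (fixLat s) 0 0 2 ∨ HasGram (fixLat s) 2 (-2) 0 := by
  have hst2 : ∀ x, s (t (t x)) = t (s x) := fun x => by rw [hst, hst, h3]
  have htt : ∀ x, t (t x) = - x - t x := fun x => by
    have := h0 x
    rw [← sub_eq_zero, ← this]; abel
  let D : HypSum →ₗ[ℤ] HypSum := t.toLinearMap - t.toLinearMap ∘ₗ t.toLinearMap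
  have hD : ∀ x, D x = t x - t (t x) := fun x => by simp [D]
  have hDD : ∀ x, D (D x) = (-3 : ℤ) • x := fun x => by
    rw [hD, hD]
    simp only [map_sub, h3]
    rw [htt x]; module
  have hDn : ∀ x, hypB (D x) (D x) = 3 * hypB x x := fun x => by
    rw [hD, htt]
    have e : hypB x x + hypB x (t x) + hypB x (t (t x)) = 0 := by
      rw [← hB_add_right, ← hB_add_right, h0, hB_zero_right]
    have e2 : hypB x (t (t x)) = hypB (t x) x := by
      rw [← ht x, h3]
    simp only [hB_add_left, hB_add_right, hB_sub_left, hB_sub_right, hB_neg_left, hB_neg_right,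
      ht x x] at *
    linarith [hB_comm x (t x)]
  have hsD : ∀ x, s (D x) = - D (s x) := fun x => by
    rw [hD, hD, map_sub, hst, hst2]; abel
  have hrank : Module.finrank ℤ (fixLat s) = 2 := by
    have h1 := fr_le (fixLat s) (fixLat s) (LinearMap.id + s.toLinearMap)
      (D ∘ₗ (LinearMap.id - s.toLinearMap)) (by
        intro x
        rw [mem_fix]
        simp [hs2, add_comm]) (by
        intro x
        rw [mem_fix]
        simp only [LinearMap.comp_apply]
        rw [hsD, ← map_neg]
        congr 1
        simp [hs2]) (by
        intro x e1 e2
        have e2 := congrArg D e2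
        simp only [LinearMap.comp_apply, hDD, map_zero] at e2
        have e3 := smul_zero_hyp (by norm_num) e2
        simp only [LinearMap.sub_apply, LinearMap.add_apply, LinearMap.id_apply,
          LinearEquiv.coe_coe] at e1 e3
        apply smul_zero_hyp (k := 2) (by norm_num)
        calc (2 : ℤ) • x = (x + s x) + (x - s x) := by module
          _ = 0 := by rw [e1, e3, add_zero])
    have h2 := fr_ge (fixLat s) (fixLat s) D (by
      intro a ha b hb e
      rw [mem_fix] at ha hb
      have e' := congrArg s e
      rw [map_add, hsD, ha, hb, map_zero] at e'
      have ea : a = 0 := by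
        apply smul_zero_hyp (k := 2) (by norm_num)
        calc (2 : ℤ) • a = (a + D b) + (a + - D b) := by module
          _ = 0 := by rw [e, e', add_zero]
      refine ⟨ea, ?_⟩
      rw [ea, zero_add] at e
      have := hDD b
      rw [e, map_zero] at this
      exact smul_zero_hyp (by norm_num) this.symm)
    omega
  obtain ⟨u, v, y, z, hS⟩ := ker_pair _ hrank
  change Dual2 (fixLat s) u v y z at hS
  have hu : s u = u := (mem_fix s u).1 ((hS.1 u).2 ⟨1, 0, by simp⟩)
  have hv : s v = v := (mem_fix s v).1 ((hS.1 v).2 ⟨0, 1, by simp⟩)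
  have hev : ∀ x x', s x = x → s x' = x' → hypB x x' = 2 * (- hypB (t x) x') := by
    intro x x' hx hx'
    have e1 : hypB (t (t x)) x' = hypB (t x) x' := by
      rw [← hs (t x) x', hst, hx, hx']
    have e2 : hypB x x' + hypB (t x) x' + hypB (t (t x)) x' = 0 := by
      rw [← hB_add_left, ← hB_add_left, h0, hB_zero_left]
    linarith
  have hdual : ∀ w, ∃ p q : ℤ, w + s w = p • u + q • v := fun w =>
    (hS.1 _).1 ((mem_fix _ _).2 (by rw [map_add, hs2, add_comm]))
  have hpair : ∀ w x, s x = x → hypB x (w + s w) = 2 * hypB x w := fun w x hx => by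
    have := hs x w
    rw [hx] at this
    rw [hB_add_right]; linarith
  obtain ⟨a, ha⟩ : ∃ a, hypB u u = 2 * a := ⟨_, hev u u hu hu⟩
  obtain ⟨b, hb⟩ : ∃ a, hypB u v = 2 * a := ⟨_, hev u v hu hv⟩
  obtain ⟨c, hc⟩ : ∃ a, hypB v v = 2 * a := ⟨_, hev v v hv hv⟩
  have hb' : hypB v u = 2 * b := by rw [hB_comm, hb]
  obtain ⟨p, q, e1⟩ := hdual y
  obtain ⟨p', q', e2⟩ := hdual z
  have a1 := hpair y u hu
  have a2 := hpair y v hv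
  have a3 := hpair z u hu
  have a4 := hpair z v hv
  obtain ⟨_, g1, g2, g3, g4⟩ := id hS
  simp only [e1, e2, hB_add_right, hB_smul_right, ha, hb, hb', hc, g1, g2, g3, g4] at a1 a2 a3 a4
  have hdet : (a * c - b ^ 2) * (p * q' - q * p') = 1 := by
    have b1 : p * a + q * b = 1 := by linarith
    have b2 : p * b + q * c = 0 := by linarith
    have b3 : p' * a + q' * b = 0 := by linarith
    have b4 : p' * b + q' * c = 1 := by linarith
    linear_combination (p' * b + q' * c) * b1 - (p' * a + q' * b) * b2 + b4
  rcases Int.mul_eq_one_iff_eq_one_or_neg_one.1 hdet with ⟨hd, _⟩ | ⟨hd, _⟩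
  · exfalso
    have ha0 : a ≠ 0 := by rintro rfl; nlinarith [sq_nonneg b]
    have hpos : ∀ x, s x = x → 0 ≤ a * hypB x x ∧ (a * hypB x x = 0 → x = 0) := by
      intro x hx
      obtain ⟨p, q, rfl⟩ := (hS.1 x).1 ((mem_fix s x).2 hx)
      have : a * hypB (p • u + q • v) (p • u + q • v) = 2 * ((a * p + b * q) ^ 2 + q ^ 2) := by
        simp only [hB_add_left, hB_add_right, hB_smul_left, hB_smul_right, ha, hb, hb', hc]
        linear_combination 2 * q ^ 2 * hd
      rw [this]
      refine ⟨by positivity, fun h => ?_⟩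
      have hq : q = 0 := by nlinarith [sq_nonneg (a * p + b * q), sq_nonneg q]
      subst hq
      have hp : p = 0 := by
        have : (a * p) ^ 2 = 0 := by linarith
        have := pow_eq_zero_iff (two_ne_zero) |>.1 this
        exact (mul_eq_zero.1 this).resolve_left ha0
      simp [hp]
    let w : HypSum := ((1, 0), (0, 0))
    have hw : hypB w w = 0 := by simp [hypB, w]
    have m1 := hpos (w + s w) (by rw [map_add, hs2, add_comm])
    have m2 := hpos (D (w - s w)) (by rw [hsD, ← map_neg]; congr 1; simp [hs2])
    rw [hDn] at m2
    have e : hypB (w + s w) (w + s w) + hypB (w - s w) (w - s w) = 0 := by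
      simp only [hB_add_left, hB_add_right, hB_sub_left, hB_sub_right, hs w w, hw]; ring
    have e' : a * hypB (w + s w) (w + s w) + a * hypB (w - s w) (w - s w) = 0 := by
      rw [← mul_add, e, mul_zero]
    have n1 := m1.2 (by linarith [m1.1, m2.1])
    have n2 := m2.2 (by linarith [m1.1, m2.1])
    have n3 := hDD (w - s w)
    rw [n2, map_zero] at n3
    have n4 := smul_zero_hyp (by norm_num) n3.symm
    have : (2 : ℤ) • w = 0 := by
      calc (2 : ℤ) • w = (w + s w) + (w - s w) := by module
        _ = 0 := by rw [n1, n4, add_zero]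
    have := congrArg (fun x : HypSum => x.1.1) this
    simp [w] at this
  · exact red1 _ _ u v y z a b c hS ha hc hb hd le_rfl

/-- A hyperbolic basis. -/
def HypBasis (b₁ b₂ b₃ b₄ : HypSum) : Prop :=
  hypB b₁ b₁ = 0 ∧ hypB b₂ b₂ = 0 ∧ hypB b₃ b₃ = 0 ∧ hypB b₄ b₄ = 0 ∧
  hypB b₁ b₂ = 1 ∧ hypB b₃ b₄ = 1 ∧ hypB b₁ b₃ = 0 ∧ hypB b₁ b₄ = 0 ∧ hypB b₂ b₃ = 0 ∧
  hypB b₂ b₄ = 0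

lemma exists_isom {b₁ b₂ b₃ b₄ : HypSum} (h : HypBasis b₁ b₂ b₃ b₄) :
    ∃ a : HypSum ≃ₗ[ℤ] HypSum, IsIsom a ∧
      ∀ x, a x = x.1.1 • b₁ + x.1.2 • b₂ + x.2.1 • b₃ + x.2.2 • b₄ := by
  obtain ⟨h1, h2, h3, h4, h12, h34, h13, h14, h23, h24⟩ := h
  have h21 : hypB b₂ b₁ = 1 := by rw [hB_comm, h12]
  have h43 : hypB b₄ b₃ = 1 := by rw [hB_comm, h34]
  have h31 : hypB b₃ b₁ = 0 := by rw [hB_comm, h13]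
  have h41 : hypB b₄ b₁ = 0 := by rw [hB_comm, h14]
  have h32 : hypB b₃ b₂ = 0 := by rw [hB_comm, h23]
  have h42 : hypB b₄ b₂ = 0 := by rw [hB_comm, h24]
  let f : HypSum →ₗ[ℤ] HypSum :=
    { toFun := fun x => x.1.1 • b₁ + x.1.2 • b₂ + x.2.1 • b₃ + x.2.2 • b₄
      map_add' := fun x y => by
        simp only [Prod.fst_add, Prod.snd_add]; module
      map_smul' := fun k x => by
        simp only [Prod.smul_fst, Prod.smul_snd, smul_eq_mul, RingHom.id_apply]; module }
  let g : HypSum →ₗ[ℤ] HypSum :=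
    { toFun := fun x => ((hypB x b₂, hypB x b₁), (hypB x b₄, hypB x b₃))
      map_add' := fun x y => by
        simp only [hB_add_left]; rfl
      map_smul' := fun k x => by
        simp only [hB_smul_left]; rfl }
  have hgf : ∀ x, g (f x) = x := fun x => by
    simp only [f, g, LinearMap.coe_mk, AddHom.coe_mk, hB_add_left, hB_smul_left,
      h1, h2, h3, h4, h12, h34, h13, h14, h23, h24, h21, h43, h31, h41, h32, h42]
    ext <;> simp
  have hgs : Function.Surjective g := fun x => ⟨f x, hgf x⟩
  have hgi : Function.Injective g := OrzechProperty.injective_of_surjective_endomorphism g hgs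
  have hfg : ∀ x, f (g x) = x := fun x => hgi (hgf _)
  refine ⟨LinearEquiv.ofLinearMap f g (LinearMap.ext hfg) (LinearMap.ext hgf), ?_, fun x => rfl⟩
  intro x y
  simp only [LinearEquiv.coe_ofLinearMap, f, LinearMap.coe_mk, AddHom.coe_mk, hB_add_left,
    hB_smul_left, hB_add_right, hB_smul_right,
      h1, h2, h3, h4, h12, h34, h13, h14, h23, h24, h21, h43, h31, h41, h32, h42]
  simp only [hypB]
  ring

lemma isom_symm {a : HypSum ≃ₗ[ℤ] HypSum} (h : IsIsom a) : IsIsom a.symm := fun x y => by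
  rw [← h (a.symm x), a.apply_symm_apply, a.apply_symm_apply]

/-- If `t`, `t'` have the same matrix in hyperbolic bases, they are conjugate. -/
lemma conj_of_basis {t t' : HypSum ≃ₗ[ℤ] HypSum} {b₁ b₂ b₃ b₄ c₁ c₂ c₃ c₄ : HypSum}
    (hb : HypBasis b₁ b₂ b₃ b₄) (hc : HypBasis c₁ c₂ c₃ c₄) (M : HypSum → HypSum)
    (ht : ∀ x : HypSum, t (x.1.1 • b₁ + x.1.2 • b₂ + x.2.1 • b₃ + x.2.2 • b₄) =
      (M x).1.1 • b₁ + (M x).1.2 • b₂ + (M x).2.1 • b₃ + (M x).2.2 • b₄)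
    (ht' : ∀ x : HypSum, t' (x.1.1 • c₁ + x.1.2 • c₂ + x.2.1 • c₃ + x.2.2 • c₄) =
      (M x).1.1 • c₁ + (M x).1.2 • c₂ + (M x).2.1 • c₃ + (M x).2.2 • c₄) :
    ∃ a : HypSum ≃ₗ[ℤ] HypSum, IsIsom a ∧
        (Subgroup.zpowers t).map (MulAut.conj a).toMonoidHom = Subgroup.zpowers t' := by
  obtain ⟨f, hf, hfe⟩ := exists_isom hb
  obtain ⟨g, hg, hge⟩ := exists_isom hc
  have e1 : ∀ x, t (f x) = f (M x) := fun x => by rw [hfe, hfe, ht]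
  have e2 : ∀ x, t' (g x) = g (M x) := fun x => by rw [hge, hge, ht']
  refine ⟨g * f⁻¹, ?_, ?_⟩
  · intro x y
    change hypB (g (f.symm x)) (g (f.symm y)) = _
    rw [hg, isom_symm hf]
  · rw [MonoidHom.map_zpowers]
    congr 1
    change (g * f⁻¹) * t * (g * f⁻¹)⁻¹ = t'
    rw [mul_inv_eq_iff_eq_mul]
    ext1 x
    change g (f.symm (t x)) = t' (g (f.symm x))
    have := e1 (f.symm x)
    rw [f.apply_symm_apply] at this
    rw [this, f.symm_apply_apply, e2]

lemma cube_pair {t : HypSum ≃ₗ[ℤ] HypSum} (ht : IsIsom t) (h3 : ∀ x, t (t (t x)) = x) (x y) :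
    hypB (t x) y = hypB x (t (t y)) := by
  rw [← ht x, h3]

lemma cube_pair' {t : HypSum ≃ₗ[ℤ] HypSum} (ht : IsIsom t) (h3 : ∀ x, t (t (t x)) = x) (x y) :
    hypB x (t y) = hypB (t (t x)) y := by
  rw [← ht _ y, h3]

lemma round_exists (D q : ℤ) (hD : 0 < D) : ∃ k r : ℤ, q = k * D + r ∧ -D ≤ 2 * r ∧ 2 * r ≤ D := by
  have h1 := Int.emod_add_mul_ediv q D
  have h2 := Int.emod_nonneg q hD.ne'
  have h3 := Int.emod_lt_of_pos q hD
  by_cases h : 2 * (q % D) ≤ D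
  · exact ⟨q / D, q % D, by linarith, by linarith, h⟩
  · exact ⟨q / D + 1, q % D - D, by linarith, by linarith, by linarith⟩

/-- Euclid in the Eisenstein integers. -/
lemma euclid (A B X Y : ℤ) (h : 0 < A ^ 2 + A * B + B ^ 2) : ∃ q r X' Y' : ℤ,
    X' = X - (q * A + r * (-A - B)) ∧ Y' = Y - (q * B + r * A) ∧
    X' ^ 2 + X' * Y' + Y' ^ 2 < A ^ 2 + A * B + B ^ 2 := by
  set D := A ^ 2 + A * B + B ^ 2 with hD
  obtain ⟨q, ρ, hq, hρ1, hρ2⟩ := round_exists D (X * A + Y * (A + B)) h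
  obtain ⟨r, σ, hr, hσ1, hσ2⟩ := round_exists D (A * Y - B * X) h
  refine ⟨q, r, _, _, rfl, rfl, ?_⟩
  set X' := X - (q * A + r * (-A - B)) with hX
  set Y' := Y - (q * B + r * A) with hY
  have e1 : D * X' = ρ * A + σ * (-A - B) := by
    rw [hX]; linear_combination A * hq + (-A - B) * hr + X * hD
  have e2 : D * Y' = ρ * B + σ * A := by
    rw [hY]; linear_combination B * hq + A * hr + Y * hD
  have e3 : D ^ 2 * (X' ^ 2 + X' * Y' + Y' ^ 2) = D * (ρ ^ 2 - ρ * σ + σ ^ 2) := by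
    calc D ^ 2 * (X' ^ 2 + X' * Y' + Y' ^ 2)
        = (D * X') ^ 2 + (D * X') * (D * Y') + (D * Y') ^ 2 := by ring
      _ = _ := by rw [e1, e2, hD]; ring
  have e4 : D * (X' ^ 2 + X' * Y' + Y' ^ 2) = ρ ^ 2 - ρ * σ + σ ^ 2 := by
    apply mul_left_cancel₀ h.ne'
    linarith
  have e5 : 4 * (ρ ^ 2 - ρ * σ + σ ^ 2) ≤ 3 * D ^ 2 := by
    nlinarith [mul_nonneg (sub_nonneg.2 hρ2) (sub_nonneg.2 hσ2), mul_nonneg (sub_nonneg.2 hρ1) (sub_nonneg.2 hσ1), mul_nonneg (sub_nonneg.2 hρ2) (sub_nonneg.2 hρ1), mul_nonneg (sub_nonneg.2 hσ2) (sub_nonneg.2 hσ1)]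
  by_contra hcon
  push Not at hcon
  nlinarith

lemma zero_of_norm {X Y : ℤ} (h : X ^ 2 + X * Y + Y ^ 2 ≤ 0) : X = 0 ∧ Y = 0 := by
  constructor <;> nlinarith [sq_nonneg (X + Y), sq_nonneg X, sq_nonneg Y, sq_nonneg (2 * X + Y), sq_nonneg (X + 2 * Y)]

theorem normal0 (t : HypSum ≃ₗ[ℤ] HypSum) (ht : IsIsom t) (h3 : ∀ x, t (t (t x)) = x)
    (h0 : ∀ x, x + t x + t (t x) = 0) :
    ∃ x y, hypB x x = 0 ∧ hypB y y = 0 ∧ hypB x y = 1 ∧ hypB (t x) y = 0 := by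
  have htt : ∀ x, t (t x) = - x - t x := fun x => by
    have := h0 x
    rw [← sub_eq_zero, ← this]; abel
  have hiso : ∀ x, hypB x x = 0 → hypB x (t x) = 0 := by
    intro x hx
    have e : hypB x x + hypB x (t x) + hypB x (t (t x)) = 0 := by
      rw [← hB_add_right, ← hB_add_right, h0, hB_zero_right]
    have e2 := cube_pair ht h3 x x
    rw [hB_comm] at e2
    linarith
  obtain ⟨x, y, hx, hxy⟩ : ∃ x y, hypB x x = 0 ∧ hypB x y = 1 :=
    ⟨((1, 0), (0, 0)), ((0, 1), (0, 0)), by simp [hypB], by simp [hypB]⟩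
  -- minimal y
  let N : HypSum → ℤ := fun y => (hypB x y) ^ 2 + hypB x y * hypB (t x) y + (hypB (t x) y) ^ 2
  have hN : ∀ y, 0 ≤ N y := fun y => by
    simp only [N]; nlinarith [sq_nonneg (hypB x y + hypB (t x) y), sq_nonneg (hypB x y), sq_nonneg (hypB (t x) y)]
  obtain ⟨y₀, hy₀, hmin⟩ : ∃ y₀, 0 < N y₀ ∧ ∀ y, 0 < N y → N y₀ ≤ N y := by
    have hex : ∃ n : ℕ, ∃ y, 0 < N y ∧ N y = n := by
      have : 0 < N y := by
        simp only [N, hxy]; nlinarith [sq_nonneg (1 + hypB (t x) y), sq_nonneg (hypB (t x) y), sq_nonneg (2 * hypB (t x) y + 1)]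
      exact ⟨(N y).toNat, y, this, by omega⟩
    classical
    obtain ⟨y₀, h1, h2⟩ := Nat.find_spec hex
    refine ⟨y₀, h1, fun y hy => ?_⟩
    have := Nat.find_min' hex ⟨y, hy, (Int.toNat_of_nonneg hy.le).symm⟩
    omega
  obtain ⟨A, hA⟩ : ∃ A, hypB x y₀ = A := ⟨_, rfl⟩
  obtain ⟨B, hB⟩ : ∃ B, hypB (t x) y₀ = B := ⟨_, rfl⟩
  have hA' : hypB x (t y₀) = -A - B := by
    rw [cube_pair' ht h3, htt, hB_sub_left, hB_neg_left, hA, hB]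
  have hB' : hypB (t x) (t y₀) = A := by rw [ht, hA]
  have hNy₀ : N y₀ = A ^ 2 + A * B + B ^ 2 := by simp only [N, hA, hB]
  rw [hNy₀] at hy₀ hmin
  have hdiv : ∀ y, ∃ q r : ℤ, hypB x y = q * A + r * (-A - B) ∧ hypB (t x) y = q * B + r * A := by
    intro y
    obtain ⟨q, r, X', Y', h1, h2, h3⟩ := euclid A B (hypB x y) (hypB (t x) y) hy₀
    have hX : hypB x (y - (q • y₀ + r • t y₀)) = X' := by
      simp only [hB_sub_right, hB_add_right, hB_smul_right, hA, hA', h1]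
    have hY : hypB (t x) (y - (q • y₀ + r • t y₀)) = Y' := by
      simp only [hB_sub_right, hB_add_right, hB_smul_right, hB, hB', h2]
    have h4 := hmin (y - (q • y₀ + r • t y₀))
    simp only [N, hX, hY] at h4
    have h5 : X' ^ 2 + X' * Y' + Y' ^ 2 ≤ 0 := by
      by_contra hcon
      push Not at hcon
      linarith [h4 hcon]
    obtain ⟨rfl, rfl⟩ := zero_of_norm h5
    exact ⟨q, r, by linarith, by linarith⟩
  obtain ⟨q1, r1, e1, f1⟩ := hdiv ((1, 0), (0, 0))
  obtain ⟨q2, r2, e2, f2⟩ := hdiv ((0, 1), (0, 0))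
  obtain ⟨q3, r3, e3, f3⟩ := hdiv ((0, 0), (1, 0))
  obtain ⟨q4, r4, e4, f4⟩ := hdiv ((0, 0), (0, 1))
  let w : HypSum := ((q2, q1), (q4, q3))
  let w' : HypSum := ((r2, r1), (r4, r3))
  have hxw : x = A • w + (-A - B) • w' := by
    simp only [hypB] at e1 e2 e3 e4
    ext <;> simp [w, w'] <;> simp at e1 e2 e3 e4 <;> linarith
  have htxw : t x = B • w + A • w' := by
    simp only [hypB] at f1 f2 f3 f4
    ext <;> simp [w, w'] <;> simp at f1 f2 f3 f4 <;> linarith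
  set E := A ^ 2 + A * B + B ^ 2 with hE
  have hEw : E • w = A • x + (A + B) • t x := by
    rw [htxw, hxw, hE]; module
  have hww : hypB w w = 0 := by
    have : hypB (E • w) (E • w) = 0 := by
      rw [hEw]
      simp only [hB_add_left, hB_add_right, hB_smul_left, hB_smul_right, ht x x, hx,
        hB_comm (t x) x, hiso x hx]
      ring
    rw [hB_smul_left, hB_smul_right] at this
    rcases mul_eq_zero.1 this with h | h
    · exact absurd h hy₀.ne'
    · exact (mul_eq_zero.1 h).resolve_left hy₀.ne'
  have hwy : hypB w y₀ = 1 := by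
    apply mul_left_cancel₀ hy₀.ne'
    rw [← hB_smul_left, hEw]
    simp only [hB_add_left, hB_smul_left, hA, hB]
    rw [hE]; ring
  have hwty : hypB w (t y₀) = 0 := by
    apply mul_left_cancel₀ hy₀.ne'
    rw [← hB_smul_left, hEw]
    simp only [hB_add_left, hB_smul_left, hA', hB']
    ring
  -- final adjustment
  let y₁ : HypSum := y₀ + t y₀
  have g1 : hypB w y₁ = 1 := by simp only [y₁, hB_add_right, hwy, hwty]; ring
  have g2 : hypB (t w) y₁ = 0 := by
    simp only [y₁, hB_add_right]
    rw [ht, cube_pair ht h3, htt, hB_sub_right, hB_neg_right, hwy, hwty]; ring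
  obtain ⟨m, hm⟩ := hB_even y₁
  refine ⟨w, y₁ - m • w, hww, ?_, ?_, ?_⟩
  · simp only [hB_sub_left, hB_sub_right, hB_smul_left, hB_smul_right, hm, hB_comm y₁ w, g1, hww]
    ring
  · simp only [hB_sub_right, hB_smul_right, g1, hww]; ring
  · simp only [hB_sub_right, hB_smul_right, g2, hB_comm (t w) w, hiso w hww]; ring

/-- matrix of `t` in the normal basis, fixed lattice zero. -/
def M0 (x : HypSum) : HypSum :=
  ((-x.2.1, -x.1.2 - x.2.2), (x.1.1 - x.2.1, x.1.2))

theorem normal0' (t : HypSum ≃ₗ[ℤ] HypSum) (ht : IsIsom t) (h3 : ∀ x, t (t (t x)) = x)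
    (h0 : ∀ x, x + t x + t (t x) = 0) :
    ∃ b₁ b₂ b₃ b₄, HypBasis b₁ b₂ b₃ b₄ ∧
    ∀ x : HypSum, t (x.1.1 • b₁ + x.1.2 • b₂ + x.2.1 • b₃ + x.2.2 • b₄) =
      (M0 x).1.1 • b₁ + (M0 x).1.2 • b₂ + (M0 x).2.1 • b₃ + (M0 x).2.2 • b₄ := by
  have htt : ∀ x, t (t x) = - x - t x := fun x => by
    have := h0 x
    rw [← sub_eq_zero, ← this]; abel
  have hiso : ∀ x, hypB x x = 0 → hypB x (t x) = 0 := by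
    intro x hx
    have e : hypB x x + hypB x (t x) + hypB x (t (t x)) = 0 := by
      rw [← hB_add_right, ← hB_add_right, h0, hB_zero_right]
    have e2 := cube_pair ht h3 x x
    rw [hB_comm] at e2
    linarith
  obtain ⟨x, y, hx, hy, hxy, htxy⟩ := normal0 t ht h3 h0
  have e1 : hypB x (t y) = -1 := by
    rw [cube_pair' ht h3, htt, hB_sub_left, hB_neg_left, hxy, htxy]; ring
  refine ⟨x, y, t x, t y + y, ?_, ?_⟩
  · refine ⟨hx, hy, ?_, ?_, hxy, ?_, hiso x hx, ?_, ?_, ?_⟩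
    · rw [ht, hx]
    · simp only [hB_add_left, hB_add_right, ht y y, hy, hiso y hy, hB_comm (t y) y]; ring
    · simp only [hB_add_right, ht x y, hxy, htxy]; ring
    · simp only [hB_add_right, hxy, e1]; ring
    · rw [hB_comm, htxy]
    · simp only [hB_add_right, hy, hiso y hy]; ring
  · intro z
    simp only [map_add, map_smul, htt, M0]
    module

/-- Data of order 3 isometry with nonzero fixed lattice: the rank two pieces. -/
def NN (t : HypSum ≃ₗ[ℤ] HypSum) : HypSum →ₗ[ℤ] HypSum :=
  LinearMap.id + t.toLinearMap + t.toLinearMap ∘ₗ t.toLinearMap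

lemma NN_apply (t : HypSum ≃ₗ[ℤ] HypSum) (x) : NN t x = x + t x + t (t x) := rfl

lemma ranks (t : HypSum ≃ₗ[ℤ] HypSum) (h3 : ∀ x, t (t (t x)) = x)
    (h1 : ∃ x, t x ≠ x) (hF : fixLat t ≠ ⊥) :
    Module.finrank ℤ (fixLat t) = 2 ∧ Module.finrank ℤ (LinearMap.ker (NN t)) = 2 := by
  have hle := fr_le (fixLat t) (LinearMap.ker (NN t)) (NN t) (t.toLinearMap - LinearMap.id)
    (fun x => by
      rw [mem_fix, NN_apply, map_add, map_add, h3]; abel)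
    (fun x => by
      rw [LinearMap.mem_ker, NN_apply]
      simp [h3])
    (fun x e1 e2 => by
      have e2 : t x = x := by simpa [sub_eq_zero] using e2
      rw [NN_apply, e2, e2] at e1
      apply smul_zero_hyp (k := 3) (by norm_num)
      rw [← e1]; module)
  have hge := fr_ge (fixLat t) (LinearMap.ker (NN t)) LinearMap.id
    (fun a ha b hb e => by
      rw [mem_fix] at ha
      rw [LinearMap.mem_ker] at hb
      have e' := congrArg (NN t) e
      rw [LinearMap.id_apply, map_add, hb, add_zero, NN_apply, ha, ha, map_zero] at e'
      have : a = 0 := by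
        apply smul_zero_hyp (k := 3) (by norm_num)
        rw [← e']; module
      refine ⟨this, ?_⟩
      simpa [this] using e)
  have hf1 : 0 < Module.finrank ℤ (fixLat t) := by
    rw [Nat.pos_iff_ne_zero]
    intro h
    exact hF (Submodule.finrank_eq_zero.1 h)
  have hk1 : 0 < Module.finrank ℤ (LinearMap.ker (NN t)) := by
    rw [Nat.pos_iff_ne_zero]
    intro h
    have := Submodule.finrank_eq_zero.1 h
    obtain ⟨x, hx⟩ := h1
    have hm : t x - x ∈ LinearMap.ker (NN t) := by
      rw [LinearMap.mem_ker, NN_apply]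
      simp [h3]
    rw [this, Submodule.mem_bot, sub_eq_zero] at hm
    exact hx hm
  have hev : Even (Module.finrank ℤ (LinearMap.ker (NN t))) := by
    let K := LinearMap.ker (NN t)
    have hmap : ∀ x ∈ K, ((2 : ℤ) • t.toLinearMap + LinearMap.id : HypSum →ₗ[ℤ] HypSum) x ∈ K := by
      intro x hx
      have hx' : x + t x + t (t x) = 0 := hx
      rw [LinearMap.mem_ker, NN_apply]
      simp only [LinearMap.add_apply, LinearMap.smul_apply, LinearMap.id_apply,
        LinearEquiv.coe_coe, map_add, map_smul, h3]
      calc _ = (3 : ℤ) • (x + t x + t (t x)) := by module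
        _ = 0 := by rw [hx', smul_zero]
    let ψ : K →ₗ[ℤ] K := LinearMap.restrict _ hmap
    have hψ : ψ * ψ = (-3 : ℤ) • LinearMap.id := by
      ext1 ⟨x, hx⟩
      have hx' : x + t x + t (t x) = 0 := hx
      apply Subtype.ext
      change (2 : ℤ) • t ((2 : ℤ) • t x + x) + ((2 : ℤ) • t x + x) = (-3 : ℤ) • x
      simp only [map_add, map_smul]
      rw [← sub_eq_zero]
      calc _ = (4 : ℤ) • (x + t x + t (t x)) := by module
        _ = 0 := by rw [hx', smul_zero]
    have hd := congrArg LinearMap.det hψ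
    rw [map_mul, LinearMap.det_smul, LinearMap.det_id, mul_one] at hd
    by_contra hodd
    rw [Nat.not_even_iff_odd] at hodd
    have : (-3 : ℤ) ^ (Module.finrank ℤ K) < 0 := hodd.pow_neg (by norm_num)
    nlinarith [mul_self_nonneg (LinearMap.det ψ)]
  obtain ⟨k, hk⟩ := hev
  omega

/-- The moving lattice is `±A₂` with basis `w, t w`. -/
lemma moving (t : HypSum ≃ₗ[ℤ] HypSum) (ht : IsIsom t) (h3 : ∀ x, t (t (t x)) = x)
    (hK : Module.finrank ℤ (LinearMap.ker (NN t)) = 2) :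
    ∃ w y z, ∃ ε : ℤ, (ε = 1 ∨ ε = -1) ∧ Dual2 (LinearMap.ker (NN t)) w (t w) y z ∧
      hypB w w = 2 * ε ∧ hypB w (t w) = -ε := by
  obtain ⟨u, v, y, z, h⟩ := ker_pair _ hK
  have hKmem : ∀ x, x ∈ LinearMap.ker (NN t) ↔ x + t x + t (t x) = 0 := fun x => Iff.rfl
  have htt : ∀ x, x ∈ LinearMap.ker (NN t) → t (t x) = - x - t x := fun x hx => by
    have := (hKmem x).1 hx
    rw [← sub_eq_zero, ← this]; abel
  have htK : ∀ x, x ∈ LinearMap.ker (NN t) → t x ∈ LinearMap.ker (NN t) := fun x hx => by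
    rw [hKmem] at *
    rw [← hx, h3]; abel
  have hmv : ∀ x, x - t x ∈ LinearMap.ker (NN t) := fun x => by
    rw [hKmem]; simp [h3]
  have hhalf : ∀ x, x ∈ LinearMap.ker (NN t) → 2 * hypB x (t x) = - hypB x x := by
    intro x hx
    have e : hypB x x + hypB x (t x) + hypB x (t (t x)) = 0 := by
      rw [← hB_add_right, ← hB_add_right, (hKmem x).1 hx, hB_zero_right]
    have e2 := cube_pair ht h3 x x
    rw [hB_comm] at e2
    linarith
  have hpr : ∀ x, x ∈ LinearMap.ker (NN t) → ∀ y, hypB x (y - t y) = 2 * hypB x y + hypB (t x) y := by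
    intro x hx y
    rw [hB_sub_right, cube_pair' ht h3, htt x hx, hB_sub_left, hB_neg_left]; ring
  have hu : u ∈ LinearMap.ker (NN t) := (h.1 u).2 ⟨1, 0, by simp⟩
  have hv : v ∈ LinearMap.ker (NN t) := (h.1 v).2 ⟨0, 1, by simp⟩
  obtain ⟨a, ha⟩ := hB_even u
  obtain ⟨c, hc⟩ := hB_even v
  obtain ⟨b, hb⟩ : ∃ b, hypB u v = b := ⟨_, rfl⟩
  have hb' : hypB v u = b := by rw [hB_comm, hb]
  obtain ⟨_, g1, g2, g3, g4⟩ := id h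
  obtain ⟨p, q, e1⟩ := (h.1 _).1 (htK u hu)
  obtain ⟨r, s, e2⟩ := (h.1 _).1 (htK v hv)
  -- relation t^2 + t + 1 = 0
  have c1 := (hKmem u).1 hu
  have c2 := (hKmem v).1 hv
  rw [e1, map_add, map_smul, map_smul, e1, e2] at c1
  rw [e2, map_add, map_smul, map_smul, e1, e2] at c2
  have d1 : p * p + q * r + p + 1 = 0 ∧ p * q + q * s + q = 0 :=
    h.zero (p' := 0) (q' := 0) (by rw [zero_smul, zero_smul, add_zero, ← c1]; module)
  have d2 : r * p + s * r + r = 0 ∧ r * q + s * s + s + 1 = 0 :=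
    h.zero (p' := 0) (q' := 0) (by rw [zero_smul, zero_smul, add_zero, ← c2]; module)
  have hq : q ≠ 0 := by
    rintro rfl
    nlinarith [d1.1, sq_nonneg (2 * p + 1)]
  have hs : s = -1 - p := by
    have : q * (p + s + 1) = 0 := by linarith [d1.2]
    have := (mul_eq_zero.1 this).resolve_left hq
    linarith
  have k1 := hhalf u hu
  have k2 := hhalf v hv
  rw [e1] at k1
  rw [e2] at k2
  simp only [hB_add_right, hB_smul_right, ha, hb, hb', hc] at k1 k2
  obtain ⟨m1, m2, i1⟩ := (h.1 _).1 (hmv y)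
  obtain ⟨m3, m4, i2⟩ := (h.1 _).1 (hmv z)
  have j1 := hpr u hu y
  have j2 := hpr v hv y
  have j3 := hpr u hu z
  have j4 := hpr v hv z
  simp only [i1, i2, e1, e2, hB_add_right, hB_smul_right, hB_add_left, hB_smul_left,
    ha, hb, hb', hc, g1, g2, g3, g4] at j1 j2 j3 j4
  set D := 4 * a * c - b ^ 2 with hD
  have hDdet : (m1 * m4 - m2 * m3) * D = 3 := by
    have : (m1 * m4 - m2 * m3) * D = (m1 * (2 * a) + m2 * b) * (m3 * b + m4 * (2 * c))
      - (m1 * b + m2 * (2 * c)) * (m3 * (2 * a) + m4 * b) := by rw [hD]; ring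
    rw [this, j1, j2, j3, j4, hs]
    linear_combination (-1 : ℤ) * d1.1
  have hDpos : 3 * b ^ 2 = (2 * p + 1) ^ 2 * D := by
    have l1 : q * b = -(2 * p + 1) * a := by linarith
    have l2 : r * b = (2 * p + 1) * c := by rw [hs] at k2; linarith
    have l3 : q * r = -(p ^ 2 + p + 1) := by linarith [d1.1]
    rw [hD]
    have l4 : (q * r) * b ^ 2 = - (2 * p + 1) ^ 2 * (a * c) := by
      linear_combination (r * b) * l1 - (2 * p + 1) * a * l2
    rw [l3] at l4
    linear_combination (-4 : ℤ) * l4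
  have hD3 : D = 3 := by
    have hdvd : D ∣ 3 := Dvd.intro_left _ hDdet
    have hnn : 0 ≤ D := by
      by_contra hneg
      push Not at hneg
      have : 2 * p + 1 ≠ 0 := by omega
      have : 0 < (2 * p + 1) ^ 2 := by positivity
      nlinarith [sq_nonneg b]
    have hle := Int.le_of_dvd (by norm_num) hdvd
    have hmod : D % 4 = 0 ∨ D % 4 = 3 := by
      rcases Int.even_or_odd' b with ⟨k, hk | hk⟩
      · left
        rw [hD, hk]
        have : 4 * a * c - (2 * k) ^ 2 = 4 * (a * c - k ^ 2) := by ring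
        omega
      · right
        rw [hD, hk]
        have : 4 * a * c - (2 * k + 1) ^ 2 = 4 * (a * c - k ^ 2 - k) - 1 := by ring
        omega
    have : D ≠ 0 := by intro h0; rw [h0] at hDdet; omega
    omega
  obtain ⟨u, v, y, z, ε, hε, h, hu2, hv2, huv⟩ := red3 _ _ u v y z a b c h ha hc hb hD3 le_rfl
  clear * - hε h hu2 hv2 huv hhalf htK ht
  have hu : u ∈ LinearMap.ker (NN t) := (h.1 u).2 ⟨1, 0, by simp⟩
  have hvu : hypB v u = -ε := by rw [hB_comm, huv]
  have k1 := hhalf u hu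
  have k2 := ht u u
  obtain ⟨p, q, e1⟩ := (h.1 _).1 (htK u hu)
  rw [e1] at k1 k2
  simp only [hB_add_left, hB_smul_left, hB_add_right, hB_smul_right, hu2, hv2, huv, hvu] at k1 k2
  have hee : ε * ε = 1 := by rcases hε with rfl | rfl <;> norm_num
  have l1 : q = 2 * p + 1 := by
    rcases hε with rfl | rfl <;> linarith
  have l2 : p * (p + 1) = 0 := by
    subst l1
    rcases hε with rfl | rfl <;> nlinarith
  rcases mul_eq_zero.1 l2 with l3 | l3
  · obtain rfl : p = 0 := l3
    obtain rfl : q = 1 := by linarith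
    have e1 : t u = v := by rw [e1]; module
    rw [← e1] at h huv
    exact ⟨u, y, z, ε, hε, h, hu2, huv⟩
  · obtain rfl : p = -1 := by linarith
    obtain rfl : q = -1 := by linarith
    have e1 : t u = -(v + (1 : ℤ) • u) := by rw [e1]; module
    have h' := (h.shear 1).neg
    rw [← e1] at h'
    refine ⟨u, _, _, ε, hε, h', hu2, ?_⟩
    linarith [hhalf u hu]

def rowv (x : HypSum) : Fin 4 → ℤ := ![x.1.1, x.1.2, x.2.1, x.2.2]

set_option maxHeartbeats 1000000 in
lemma gram_mat (a b c d : HypSum) :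
    (Matrix.of ![rowv a, rowv b, rowv c, rowv d]) *
      (!![0, 1, 0, 0; 1, 0, 0, 0; 0, 0, 0, 1; 0, 0, 1, 0] : Matrix (Fin 4) (Fin 4) ℤ) *
      (Matrix.of ![rowv a, rowv b, rowv c, rowv d]).transpose =
    !![hypB a a, hypB a b, hypB a c, hypB a d; hypB b a, hypB b b, hypB b c, hypB b d;
      hypB c a, hypB c b, hypB c c, hypB c d; hypB d a, hypB d b, hypB d c, hypB d d] := by
  ext i j
  fin_cases i <;> fin_cases j <;>
    simp [rowv, hypB, Matrix.mul_apply, Fin.sum_univ_four] <;> ring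

lemma A2_pos {p q : ℤ} (h : p ^ 2 - p * q + q ^ 2 ≤ 0) : p = 0 ∧ q = 0 := by
  have := zero_of_norm (X := p) (Y := -q) (by linarith)
  exact ⟨this.1, by linarith [this.2]⟩

set_option maxHeartbeats 1000000 in
lemma det_fix (w w' y z f1 f2 : HypSum) (ε a b c : ℤ) (hε : ε * ε = 1)
    (hww : hypB w w = 2 * ε) (hww' : hypB w w' = -ε) (hw'w' : hypB w' w' = 2 * ε)
    (o1 : hypB w f1 = 0) (o2 : hypB w f2 = 0) (o3 : hypB w' f1 = 0) (o4 : hypB w' f2 = 0)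
    (ha : hypB f1 f1 = 2 * a) (hb : hypB f1 f2 = b) (hc : hypB f2 f2 = 2 * c)
    (hdec : ∀ x, ∃ p q : ℤ, x = hypB x w • y + hypB x w' • z + p • f1 + q • f2) :
    4 * a * c - b ^ 2 = 3 := by
  have hw'w : hypB w' w = -ε := by rw [hB_comm, hww']
  let J : Matrix (Fin 4) (Fin 4) ℤ := !![0, 1, 0, 0; 1, 0, 0, 0; 0, 0, 0, 1; 0, 0, 1, 0]
  let Y : Matrix (Fin 4) (Fin 4) ℤ := Matrix.of ![rowv y, rowv z, rowv f1, rowv f2]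
  let K : Matrix (Fin 4) (Fin 4) ℤ := Matrix.of ![rowv w, rowv w', rowv f1, rowv f2]
  have hJ : J.det = 1 := by
    simp [J, Matrix.det_succ_row_zero, Fin.sum_univ_succ, Fin.succAbove]
  obtain ⟨p1, q1, i1⟩ := hdec w
  obtain ⟨p2, q2, i2⟩ := hdec w'
  rw [hww, hww'] at i1
  rw [hw'w, hw'w'] at i2
  let T : Matrix (Fin 4) (Fin 4) ℤ := !![2 * ε, -ε, p1, q1; -ε, 2 * ε, p2, q2; 0, 0, 1, 0; 0, 0, 0, 1]
  have hT : T.det = 3 := by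
    simp [T, Matrix.det_succ_row_zero, Fin.sum_univ_succ, Fin.succAbove]
    linear_combination 3 * hε
  have hK : K = T * Y := by
    ext i j
    fin_cases i
    · have := congrFun (congrArg rowv i1) j
      fin_cases j <;> simp [rowv] at this <;>
        simp [K, T, Y, rowv, Matrix.mul_apply, Fin.sum_univ_four] <;> linarith
    · have := congrFun (congrArg rowv i2) j
      fin_cases j <;> simp [rowv] at this <;>
        simp [K, T, Y, rowv, Matrix.mul_apply, Fin.sum_univ_four] <;> linarith
    · fin_cases j <;> simp [K, T, Y, rowv, Matrix.mul_apply, Fin.sum_univ_four]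
    · fin_cases j <;> simp [K, T, Y, rowv, Matrix.mul_apply, Fin.sum_univ_four]
  obtain ⟨r1, s1, j1⟩ := hdec ((1, 0), (0, 0))
  obtain ⟨r2, s2, j2⟩ := hdec ((0, 1), (0, 0))
  obtain ⟨r3, s3, j3⟩ := hdec ((0, 0), (1, 0))
  obtain ⟨r4, s4, j4⟩ := hdec ((0, 0), (0, 1))
  let X : Matrix (Fin 4) (Fin 4) ℤ :=
    !![hypB ((1, 0), (0, 0)) w, hypB ((1, 0), (0, 0)) w', r1, s1;
      hypB ((0, 1), (0, 0)) w, hypB ((0, 1), (0, 0)) w', r2, s2;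
      hypB ((0, 0), (1, 0)) w, hypB ((0, 0), (1, 0)) w', r3, s3;
      hypB ((0, 0), (0, 1)) w, hypB ((0, 0), (0, 1)) w', r4, s4]
  have hXY : X * Y = 1 := by
    ext i j
    fin_cases i
    · have := congrFun (congrArg rowv j1) j
      fin_cases j <;> simp [rowv] at this <;>
        simp [X, Y, rowv, Matrix.mul_apply, Fin.sum_univ_four] <;> linarith
    · have := congrFun (congrArg rowv j2) j
      fin_cases j <;> simp [rowv] at this <;>
        simp [X, Y, rowv, Matrix.mul_apply, Fin.sum_univ_four] <;> linarith
    · have := congrFun (congrArg rowv j3) j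
      fin_cases j <;> simp [rowv] at this <;>
        simp [X, Y, rowv, Matrix.mul_apply, Fin.sum_univ_four] <;> linarith
    · have := congrFun (congrArg rowv j4) j
      fin_cases j <;> simp [rowv] at this <;>
        simp [X, Y, rowv, Matrix.mul_apply, Fin.sum_univ_four] <;> linarith
  have hY : Y.det ^ 2 = 1 := by
    have := congrArg Matrix.det hXY
    rw [Matrix.det_mul, Matrix.det_one] at this
    rcases Int.mul_eq_one_iff_eq_one_or_neg_one.1 this with h | h <;> rw [h.2] <;> norm_num
  have hG : K * J * K.transpose = !![2 * ε, -ε, 0, 0; -ε, 2 * ε, 0, 0; 0, 0, 2 * a, b; 0, 0, b, 2 * c] := by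
    have o1' := (hB_comm f1 w).trans o1
    have o2' := (hB_comm f2 w).trans o2
    have o3' := (hB_comm f1 w').trans o3
    have o4' := (hB_comm f2 w').trans o4
    have hb' := (hB_comm f2 f1).trans hb
    rw [gram_mat, hww, hww', hw'w, hw'w', o1, o2, o3, o4, o1', o2', o3', o4', ha, hb, hb', hc]
  have hd := congrArg Matrix.det hG
  rw [Matrix.det_mul, Matrix.det_mul, Matrix.det_transpose, hJ, hK, Matrix.det_mul, hT] at hd
  have hd2 : (!![2 * ε, -ε, 0, 0; -ε, 2 * ε, 0, 0; 0, 0, 2 * a, b; 0, 0, b, 2 * c] :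
      Matrix (Fin 4) (Fin 4) ℤ).det = 3 * (ε * ε) * (4 * a * c - b ^ 2) := by
    simp [Matrix.det_succ_row_zero, Fin.sum_univ_succ, Fin.succAbove]
    ring
  rw [hd2, hε] at hd
  have : 9 * Y.det ^ 2 = 3 * (4 * a * c - b ^ 2) := by linarith
  rw [hY] at this
  linarith

theorem caseF (t : HypSum ≃ₗ[ℤ] HypSum) (ht : IsIsom t) (h3 : ∀ x, t (t (t x)) = x)
    (h1 : ∃ x, t x ≠ x) (hF : fixLat t ≠ ⊥) :
    ∃ ε : ℤ, (ε = 1 ∨ ε = -1) ∧ HasGram (fixLat t) (-2 * ε) (-2 * ε) ε ∧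
      ∃ g f, hypB g g = 0 ∧ hypB g (t g) = -ε ∧ t f = f ∧ hypB f f = -2 * ε ∧ hypB f g = -ε := by
  obtain ⟨hrF, hrK⟩ := ranks t h3 h1 hF
  obtain ⟨w, y, z, ε, hε, hK, hww, hwtw⟩ := moving t ht h3 hrK
  have hee : ε * ε = 1 := by rcases hε with rfl | rfl <;> norm_num
  have hwK : w + t w + t (t w) = 0 := (hK.1 w).2 ⟨1, 0, by simp⟩
  have htt : t (t w) = -w - t w := by
    rw [← sub_eq_zero, ← hwK]; abel
  have htwtw : hypB (t w) (t w) = 2 * ε := by rw [ht, hww]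
  have htww : hypB (t w) w = -ε := by rw [hB_comm, hwtw]
  have hperp : ∀ x, t x = x → hypB w x = 0 ∧ hypB (t w) x = 0 := by
    intro x hx
    have e1 : hypB (t w) x = hypB w x := by
      conv_lhs => rw [← hx, ht]
    have e2 : hypB (t (t w)) x = hypB (t w) x := by
      conv_lhs => rw [← hx, ht]
    have e3 : hypB w x + hypB (t w) x + hypB (t (t w)) x = 0 := by
      rw [← hB_add_left, ← hB_add_left, hwK, hB_zero_left]
    constructor <;> linarith
  have hperp' : ∀ x, hypB x w = 0 → hypB x (t w) = 0 → t x = x := by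
    intro x e1 e2
    obtain ⟨p, q, e⟩ := (hK.1 (x - t x)).1 (by
      rw [LinearMap.mem_ker, NN_apply]; simp [h3])
    have k1 : hypB (x - t x) w = 0 := by
      rw [hB_sub_left, cube_pair ht h3, htt, hB_sub_right, hB_neg_right, e1, e2]; ring
    have k2 : hypB (x - t x) (t w) = 0 := by
      rw [hB_sub_left, ht, e1, e2]; ring
    rw [e] at k1 k2
    simp only [hB_add_left, hB_smul_left, hww, hwtw, htwtw, htww] at k1 k2
    have l : p = 0 ∧ q = 0 := by
      rcases hε with rfl | rfl <;> constructor <;> linarith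
    rw [l.1, l.2, zero_smul, zero_smul, add_zero, sub_eq_zero] at e
    exact e.symm
  obtain ⟨f1, f2, z1, z2, hf⟩ := ker_pair _ hrF
  change Dual2 (fixLat t) f1 f2 z1 z2 at hf
  obtain ⟨a, ha⟩ := hB_even f1
  obtain ⟨c, hc⟩ := hB_even f2
  obtain ⟨b, hb⟩ : ∃ b, hypB f1 f2 = b := ⟨_, rfl⟩
  obtain ⟨_, g1, g2, g3, g4⟩ := id hK
  have g1' : hypB y w = 1 := by rw [hB_comm, g1]
  have g2' : hypB z w = 0 := by rw [hB_comm, g2]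
  have g3' : hypB y (t w) = 0 := by rw [hB_comm, g3]
  have g4' : hypB z (t w) = 1 := by rw [hB_comm, g4]
  have m1 := (mem_fix t f1).1 ((hf.1 f1).2 ⟨1, 0, by simp⟩)
  have m2 := (mem_fix t f2).1 ((hf.1 f2).2 ⟨0, 1, by simp⟩)
  have hD : 4 * a * c - b ^ 2 = 3 := by
    refine det_fix w (t w) y z f1 f2 ε a b c hee hww hwtw htwtw (hperp f1 m1).1 (hperp f2 m2).1
      (hperp f1 m1).2 (hperp f2 m2).2 ha hb hc ?_
    intro x
    obtain ⟨p, q, e⟩ := (hf.1 (x - hypB x w • y - hypB x (t w) • z)).1 ((mem_fix _ _).2 (hperp' _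
      (by simp only [hB_sub_left, hB_smul_left, g1', g2']; ring)
      (by simp only [hB_sub_left, hB_smul_left, g3', g4']; ring)))
    refine ⟨p, q, ?_⟩
    rw [add_assoc, ← e]; abel
  obtain ⟨f1, f2, z1, z2, δ, hδ, hf, hf1, hf2, hf12⟩ :=
    red3 _ _ f1 f2 z1 z2 a b c hf ha hc hb hD le_rfl
  clear hD ha hb hc m1 m2 a b c
  have m1 := (mem_fix t f1).1 ((hf.1 f1).2 ⟨1, 0, by simp⟩)
  have m2 := (mem_fix t f2).1 ((hf.1 f2).2 ⟨0, 1, by simp⟩)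
  have hf21 : hypB f2 f1 = -δ := by rw [hB_comm, hf12]
  have hδε : δ = -ε := by
    by_contra hne
    obtain rfl : δ = ε := by omega
    let x : HypSum := ((1, 0), (0, 0))
    obtain ⟨p, q, e⟩ := (hf.1 (x + t x + t (t x))).1 ((mem_fix _ _).2 (by
      simp only [map_add, h3]; abel))
    obtain ⟨p', q', e'⟩ := (hK.1 ((x - t x) + (x - t (t x)))).1 (by
      rw [LinearMap.mem_ker, NN_apply]; simp only [map_add, map_sub, h3]; abel)
    have hx : (3 : ℤ) • x = (p • f1 + q • f2) + (p' • w + q' • t w) := by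
      rw [← e, ← e']; module
    have hn : hypB ((3 : ℤ) • x) ((3 : ℤ) • x) = 0 := by simp [hypB, x]
    rw [hx] at hn
    simp only [hB_add_left, hB_smul_left, hB_add_right, hB_smul_right, hf1, hf2, hf12, hf21,
      hww, hwtw, htww, htwtw, hB_comm f1, hB_comm f2, (hperp f1 m1).1, (hperp f2 m2).1,
      (hperp f1 m1).2, (hperp f2 m2).2] at hn
    have hn' : (p ^ 2 - p * q + q ^ 2) + (p' ^ 2 - p' * q' + q' ^ 2) = 0 := by
      rcases hδ with rfl | rfl <;> linarith
    have n1 : 0 ≤ p ^ 2 - p * q + q ^ 2 := by nlinarith [sq_nonneg (p - q), sq_nonneg p, sq_nonneg q]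
    have n2 : 0 ≤ p' ^ 2 - p' * q' + q' ^ 2 := by nlinarith [sq_nonneg (p' - q'), sq_nonneg p', sq_nonneg q']
    obtain ⟨rfl, rfl⟩ := A2_pos (p := p) (q := q) (by linarith)
    obtain ⟨rfl, rfl⟩ := A2_pos (p := p') (q := q') (by linarith)
    have := congrArg (fun x : HypSum => x.1.1) hx
    simp [x] at this
  subst hδε
  refine ⟨ε, hε, hf.gram (by rw [hf1]; ring) (by rw [hf2]; ring) (by rw [hf12]; ring), ?_⟩
  -- glue
  obtain ⟨γ, δ, e⟩ := (hf.1 ((3 : ℤ) • y - ε • ((2 : ℤ) • w + t w))).1 ((mem_fix _ _).2 (hperp' _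
      (by simp only [hB_sub_left, hB_add_left, hB_smul_left, g1', hww, htww]; linear_combination (-3 : ℤ) * hee)
      (by simp only [hB_sub_left, hB_add_left, hB_smul_left, g3', hwtw, htwtw]; ring)))
  obtain ⟨k, hk⟩ : ∃ k, hypB y f1 = k := ⟨_, rfl⟩
  have hδ' : δ = 2 * γ + 3 * ε * k := by
    have := congrArg (fun x => hypB x f1) e
    simp only [hB_sub_left, hB_add_left, hB_smul_left, hk, (hperp f1 m1).1, (hperp f1 m1).2,
      hf1, hf21] at this
    linear_combination (-ε) * this + (2 * γ - δ) * hee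
  have hmain : ∃ m σ : ℤ, (σ = 1 ∨ σ = -1) ∧ γ = 3 * m + σ := by
    have : γ % 3 = 0 ∨ γ % 3 = 1 ∨ γ % 3 = 2 := by omega
    rcases this with h | h | h
    · exfalso
      obtain ⟨m, rfl⟩ := Int.dvd_of_emod_eq_zero h
      have hz : ε • ((2 : ℤ) • w + t w) = (3 : ℤ) • (y - m • f1 - (2 * m + ε * k) • f2) := by
        have : ε • ((2 : ℤ) • w + t w) = (3 : ℤ) • y - ((3 * m) • f1 + δ • f2) := by
          rw [← e]; abel
        rw [this, hδ']; module
      have := congrArg (fun x => hypB x y) hz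
      simp only [hB_add_left, hB_smul_left, g1, g3] at this
      rcases hε with rfl | rfl <;> omega
    · exact ⟨γ / 3, 1, Or.inl rfl, by omega⟩
    · exact ⟨γ / 3 + 1, -1, Or.inr rfl, by omega⟩
  obtain ⟨m, σ, hσ, hγ⟩ := hmain
  have hss : σ * σ = 1 := by rcases hσ with rfl | rfl <;> norm_num
  let g : HypSum := y - (ε * k) • f2 - m • (f1 + (2 : ℤ) • f2)
  have hg : (3 : ℤ) • g = ε • ((2 : ℤ) • w + t w) + σ • (f1 + (2 : ℤ) • f2) := by
    have : (3 : ℤ) • y = ε • ((2 : ℤ) • w + t w) + (γ • f1 + δ • f2) := by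
      rw [← e]; abel
    have h4 : (3 : ℤ) • g = (3 : ℤ) • y - (3 * (ε * k)) • f2 - (3 * m) • (f1 + (2 : ℤ) • f2) := by
      simp only [g]; module
    rw [h4, this, hδ', hγ]; module
  have hpf1 := hperp f1 m1
  have hpf2 := hperp f2 m2
  have htg : (3 : ℤ) • t g = ε • (t w - w) + σ • (f1 + (2 : ℤ) • f2) := by
    rw [← map_smul, hg]
    simp only [map_add, map_smul, m1, m2, htt]; module
  refine ⟨g, σ • f2, ?_, ?_, by rw [map_smul, m2], ?_, ?_⟩
  · have : hypB ((3 : ℤ) • g) ((3 : ℤ) • g) = 0 := by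
      rw [hg]
      simp only [hB_add_left, hB_smul_left, hB_add_right, hB_smul_right, hf1, hf2, hf12, hf21,
        hww, hwtw, htww, htwtw, hB_comm f1, hB_comm f2, hpf1.1, hpf1.2, hpf2.1, hpf2.2]
      linear_combination 6 * ε * hee - 6 * ε * hss
    rw [hB_smul_left, hB_smul_right] at this
    omega
  · have : hypB ((3 : ℤ) • g) ((3 : ℤ) • t g) = - 9 * ε := by
      rw [hg, htg]
      simp only [hB_add_left, hB_smul_left, hB_add_right, hB_smul_right, hf1, hf2, hf12, hf21,
        hww, hwtw, htww, htwtw, hB_comm f1, hB_comm f2, hpf1.1, hpf1.2, hpf2.1, hpf2.2,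
        hB_sub_right, hB_sub_left]
      linear_combination (-3) * ε * hee - 6 * ε * hss
    rw [hB_smul_left, hB_smul_right] at this
    omega
  · rw [hB_smul_left, hB_smul_right, hf2]; linear_combination (-2) * ε * hss
  · have : hypB (σ • f2) ((3 : ℤ) • g) = -3 * ε := by
      rw [hg]
      simp only [hB_add_left, hB_smul_left, hB_add_right, hB_smul_right, hf1, hf2, hf12, hf21,
        hB_comm f2 w, hB_comm f2 (t w), hpf2.1, hpf2.2]
      linear_combination (-3) * ε * hss
    rw [hB_smul_right] at this
    omega

/-- matrix of `t` in the normal basis, fixed lattice `A₂(∓1)`. -/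
def Me (ε : ℤ) (x : HypSum) : HypSum :=
  ((-ε * x.1.2, -ε * x.1.1 + x.1.2 + ε * x.2.1 + x.2.2), (-ε * x.1.2 - ε * x.2.2,
    - x.1.2 - ε * x.2.1))

theorem normalF (t : HypSum ≃ₗ[ℤ] HypSum) (ht : IsIsom t) (h3 : ∀ x, t (t (t x)) = x)
    (ε : ℤ) (hee : ε * ε = 1) (g f : HypSum) (hg : hypB g g = 0) (hgt : hypB g (t g) = -ε)
    (hf : t f = f) (hff : hypB f f = -2 * ε) (hfg : hypB f g = -ε) :
    ∃ b₁ b₂ b₃ b₄, HypBasis b₁ b₂ b₃ b₄ ∧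
    ∀ x : HypSum, t (x.1.1 • b₁ + x.1.2 • b₂ + x.2.1 • b₃ + x.2.2 • b₄) =
      (Me ε x).1.1 • b₁ + (Me ε x).1.2 • b₂ + (Me ε x).2.1 • b₃ + (Me ε x).2.2 • b₄ := by
  have e1 : hypB (t g) (t g) = 0 := by rw [ht, hg]
  have e2 : hypB (t (t g)) (t (t g)) = 0 := by rw [ht, e1]
  have e3 : hypB (t g) (t (t g)) = -ε := by rw [ht, hgt]
  have e4 : hypB g (t (t g)) = -ε := by rw [← cube_pair ht h3, hB_comm, hgt]
  have e5 : hypB f (t g) = -ε := by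
    conv_lhs => rw [← hf, ht]
    exact hfg
  have e6 : hypB f (t (t g)) = -ε := by
    conv_lhs => rw [← hf, ht]
    exact e5
  have r1 := hB_comm (t g) g
  have r2 := hB_comm (t (t g)) g
  have r3 := hB_comm (t (t g)) (t g)
  have r4 := hB_comm g f
  have r5 := hB_comm (t g) f
  have r6 := hB_comm (t (t g)) f
  refine ⟨g, (-ε) • t g, f - g - t g, ε • (t (t g) - f), ?_, ?_⟩
  · refine ⟨?_, ?_, ?_, ?_, ?_, ?_, ?_, ?_, ?_, ?_⟩ <;>
    simp only [hB_add_left, hB_smul_left, hB_add_right, hB_smul_right, hB_sub_right, hB_sub_left,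
      r1, r2, r3, r4, r5, r6, e1, e2, e3, e4, e5, e6, hg, hgt, hff, hfg] <;>
    linarith
  · intro x
    simp only [map_add, map_smul, map_sub, h3, hf, Me]
    rcases Int.mul_eq_one_iff_eq_one_or_neg_one.1 hee with ⟨rfl, _⟩ | ⟨rfl, _⟩ <;> module


lemma cube_of {t : HypSum ≃ₗ[ℤ] HypSum} (h : t ^ 3 = 1) (x : HypSum) : t (t (t x)) = x := by
  have := congrArg (fun f : HypSum ≃ₗ[ℤ] HypSum => f x) h
  simpa [pow_succ] using this

lemma sq_of {t : HypSum ≃ₗ[ℤ] HypSum} (h : t ^ 2 = 1) (x : HypSum) : t (t x) = x := by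
  have := congrArg (fun f : HypSum ≃ₗ[ℤ] HypSum => f x) h
  simpa [pow_succ] using this

lemma ne_of {t : HypSum ≃ₗ[ℤ] HypSum} (h : t ≠ 1) : ∃ x, t x ≠ x := by
  by_contra hc
  push Not at hc
  exact h (LinearEquiv.ext fun x => by simpa using hc x)

lemma inv_of {t s : HypSum ≃ₗ[ℤ] HypSum} (h3 : ∀ x, t (t (t x)) = x) (hs : ∀ x, s (s x) = x)
    (h : s * t * s = t⁻¹) (x : HypSum) : s (t x) = t (t (s x)) := by
  have h1 : t * (s * t * s) = 1 := by rw [h]; exact mul_inv_cancel t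
  have h2 := congrArg (fun f : HypSum ≃ₗ[ℤ] HypSum => f (s x)) h1
  simp only [LinearEquiv.mul_apply, LinearEquiv.coe_one, id] at h2
  rw [hs] at h2
  have h4 := congrArg (fun y => t (t y)) h2
  rw [h3] at h4
  exact h4

lemma zero_of_bot {t : HypSum ≃ₗ[ℤ] HypSum} (h3 : ∀ x, t (t (t x)) = x) (h : fixLat t = ⊥)
    (x : HypSum) : x + t x + t (t x) = 0 := by
  have : x + t x + t (t x) ∈ fixLat t := by
    rw [mem_fix, map_add, map_add, h3]
    abel
  rw [h] at this
  exact (Submodule.mem_bot ℤ).1 this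

lemma norm_comb {u v : HypSum} {ε : ℤ} (hu : hypB u u = -2 * ε) (hv : hypB v v = -2 * ε)
    (huv : hypB u v = ε) (p q : ℤ) :
    hypB (p • u + q • v) (p • u + q • v) = -2 * ε * (p ^ 2 - p * q + q ^ 2) := by
  have hvu : hypB v u = ε := (hB_comm v u).trans huv
  simp only [hB_add_left, hB_add_right, hB_smul_left, hB_smul_right, hu, hv, huv, hvu]
  ring

lemma sq_form_nonneg (p q : ℤ) : 0 ≤ p ^ 2 - p * q + q ^ 2 := by
  nlinarith [sq_nonneg (p - q), sq_nonneg p, sq_nonneg q]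

lemma gram_sign {S : Submodule ℤ HypSum} {ε : ℤ} (h : HasGram S (-2 * ε) (-2 * ε) ε)
    {x : HypSum} (hx : x ∈ S) : ∃ n : ℤ, 0 ≤ n ∧ hypB x x = -2 * ε * n := by
  obtain ⟨u, v, -, -, hu, hv, huv, hs⟩ := h
  rw [← hs, Submodule.mem_span_pair] at hx
  obtain ⟨p, q, rfl⟩ := hx
  exact ⟨_, sq_form_nonneg p q, norm_comb hu hv huv p q⟩

lemma eps_eq {ε ε' n : ℤ} (h : ε = 1 ∨ ε = -1) (h' : ε' = 1 ∨ ε' = -1) (hn : 0 ≤ n)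
    (e : -2 * ε = -2 * ε' * n) : ε = ε' := by
  rcases h with rfl | rfl <;> rcases h' with rfl | rfl <;> omega

lemma gram_ne_bot {S : Submodule ℤ HypSum} {a b c : ℤ} (h : HasGram S a b c) (ha : a ≠ 0) :
    S ≠ ⊥ := by
  rintro rfl
  obtain ⟨u, v, hu, -, h1, -⟩ := h
  rw [Submodule.mem_bot] at hu
  subst hu
  rw [hB_zero_left] at h1
  exact ha h1.symm

theorem part1 (t : HypSum ≃ₗ[ℤ] HypSum) (ht : IsIsom t) (h3 : t ^ 3 = 1) (h1 : t ≠ 1) :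
    ((HasGram (fixLat t) (-2) (-2) 1 ∨ HasGram (fixLat t) 2 2 (-1) ∨ fixLat t = ⊥) ∧
        ¬(HasGram (fixLat t) (-2) (-2) 1 ∧ HasGram (fixLat t) 2 2 (-1)) ∧
        ¬(HasGram (fixLat t) (-2) (-2) 1 ∧ fixLat t = ⊥) ∧
        ¬(HasGram (fixLat t) 2 2 (-1) ∧ fixLat t = ⊥)) := by
  refine ⟨?_, ?_, fun h => gram_ne_bot h.1 (by norm_num) h.2,
    fun h => gram_ne_bot h.1 (by norm_num) h.2⟩
  · by_cases hF : fixLat t = ⊥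
    · exact Or.inr (Or.inr hF)
    · obtain ⟨ε, rfl | rfl, hG, -⟩ := caseF t ht (cube_of h3) (ne_of h1) hF
      · exact Or.inl (by simpa using hG)
      · exact Or.inr (Or.inl (by simpa using hG))
  · rintro ⟨⟨u, v, hu, -, h2, -⟩, hb⟩
    have hb' : HasGram (fixLat t) (-2 * (-1)) (-2 * (-1)) (-1) := by simpa using hb
    obtain ⟨n, hn, e⟩ := gram_sign hb' hu
    omega

theorem part2 (t t' : HypSum ≃ₗ[ℤ] HypSum) (ht : IsIsom t) (h3 : t ^ 3 = 1) (h1 : t ≠ 1)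
    (ht' : IsIsom t') (h3' : t' ^ 3 = 1) (h1' : t' ≠ 1)
    (h : ∃ e : fixLat t ≃ₗ[ℤ] fixLat t',
      ∀ x y : fixLat t, hypB (e x : HypSum) (e y : HypSum) = hypB (x : HypSum) (y : HypSum)) :
    ∃ a : HypSum ≃ₗ[ℤ] HypSum, IsIsom a ∧
      (Subgroup.zpowers t).map (MulAut.conj a).toMonoidHom = Subgroup.zpowers t' := by
  obtain ⟨e, he⟩ := h
  by_cases hF : fixLat t = ⊥
  · have hF' : fixLat t' = ⊥ := by
      rw [Submodule.eq_bot_iff]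
      intro x hx
      have h5 : e.symm ⟨x, hx⟩ = 0 := by
        apply Subtype.ext
        have := (e.symm ⟨x, hx⟩).2
        exact (Submodule.mem_bot ℤ).1 (hF.le this)
      have h6 : (⟨x, hx⟩ : fixLat t') = 0 := by
        rw [← e.apply_symm_apply ⟨x, hx⟩, h5, map_zero]
      exact congrArg Subtype.val h6
    obtain ⟨b₁, b₂, b₃, b₄, hb, hbt⟩ := normal0' t ht (cube_of h3) (zero_of_bot (cube_of h3) hF)
    obtain ⟨c₁, c₂, c₃, c₄, hc, hct⟩ :=
      normal0' t' ht' (cube_of h3') (zero_of_bot (cube_of h3') hF')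
    exact conj_of_basis hb hc M0 hbt hct
  · have hF' : fixLat t' ≠ ⊥ := by
      intro hF'
      apply hF
      rw [Submodule.eq_bot_iff]
      intro x hx
      have h5 : e ⟨x, hx⟩ = 0 := by
        apply Subtype.ext
        have := (e ⟨x, hx⟩).2
        exact (Submodule.mem_bot ℤ).1 (hF'.le this)
      have h6 : (⟨x, hx⟩ : fixLat t) = 0 := by
        rw [← e.symm_apply_apply ⟨x, hx⟩, h5, map_zero]
      exact congrArg Subtype.val h6
    obtain ⟨ε, hε, hG, g, f, i1, i2, i3, i4, i5⟩ := caseF t ht (cube_of h3) (ne_of h1) hF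
    obtain ⟨ε', hε', hG', g', f', j1, j2, j3, j4, j5⟩ :=
      caseF t' ht' (cube_of h3') (ne_of h1') hF'
    have hee : ε = ε' := by
      obtain ⟨u, v, hu, -, h2, -⟩ := hG
      obtain ⟨n, hn, h7⟩ := gram_sign hG' (e ⟨u, hu⟩).2
      rw [he, h2] at h7
      exact eps_eq hε hε' hn h7
    subst hee
    have hsq : ε * ε = 1 := by rcases hε with rfl | rfl <;> norm_num
    obtain ⟨b₁, b₂, b₃, b₄, hb, hbt⟩ := normalF t ht (cube_of h3) ε hsq g f i1 i2 i3 i4 i5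
    obtain ⟨c₁, c₂, c₃, c₄, hc, hct⟩ := normalF t' ht' (cube_of h3') ε hsq g' f' j1 j2 j3 j4 j5
    exact conj_of_basis hb hc (Me ε) hbt hct

/-- A linear equivalence from a linear map with an explicit two-sided inverse. -/
lemma exists_equiv (f g : HypSum → HypSum) (hadd : ∀ x y, f (x + y) = f x + f y)
    (hsmul : ∀ (c : ℤ) x, f (c • x) = c • f x) (h1 : ∀ x, g (f x) = x) (h2 : ∀ x, f (g x) = x) :
    ∃ t : HypSum ≃ₗ[ℤ] HypSum, ∀ x, t x = f x :=
  ⟨{ toFun := f, invFun := g, map_add' := hadd, map_smul' := hsmul, left_inv := h1,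
     right_inv := h2 }, fun _ => rfl⟩

lemma Me_cube (ε : ℤ) (h : ε * ε = 1) (x : HypSum) : Me ε (Me ε (Me ε x)) = x := by
  have h3 : ε ^ 3 = ε := by linear_combination ε * h
  obtain ⟨⟨a, b⟩, ⟨c, d⟩⟩ := x
  rcases mul_self_eq_one_iff.1 h with rfl | rfl <;>
    simp only [Me, Prod.mk.injEq] <;> refine ⟨⟨?_, ?_⟩, ⟨?_, ?_⟩⟩ <;> first | trivial | ring

lemma existsF (ε : ℤ) (h : ε = 1 ∨ ε = -1) : ∃ t : HypSum ≃ₗ[ℤ] HypSum, IsIsom t ∧ t ^ 3 = 1 ∧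
    t ≠ 1 ∧ HasGram (fixLat t) (-2 * ε) (-2 * ε) ε := by
  have hee : ε * ε = 1 := by rcases h with rfl | rfl <;> norm_num
  obtain ⟨t, ht⟩ := exists_equiv (Me ε) (fun x => Me ε (Me ε x))
    (by rintro ⟨⟨a, b⟩, ⟨c, d⟩⟩ ⟨⟨a', b'⟩, ⟨c', d'⟩⟩
        simp only [Me, Prod.mk_add_mk, Prod.mk.injEq]
        refine ⟨⟨?_, ?_⟩, ⟨?_, ?_⟩⟩ <;> first | trivial | ring)
    (by rintro k ⟨⟨a, b⟩, ⟨c, d⟩⟩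
        simp only [Me, Prod.smul_mk, Prod.mk.injEq, smul_eq_mul]
        refine ⟨⟨?_, ?_⟩, ⟨?_, ?_⟩⟩ <;> first | trivial | ring)
    (Me_cube ε hee) (Me_cube ε hee)
  refine ⟨t, ?_, ?_, ?_, ((1, -ε), (1, 0)), ((-1, ε), (0, -ε)), ?_, ?_, ?_, ?_, ?_, ?_⟩
  · rintro ⟨⟨a, b⟩, ⟨c, d⟩⟩ ⟨⟨a', b'⟩, ⟨c', d'⟩⟩
    rw [ht, ht]
    simp only [Me, hypB]
    rcases h with rfl | rfl <;> ring
  · ext1 x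
    have : t (t (t x)) = x := by rw [ht, ht, ht, Me_cube ε hee]
    simpa [pow_succ] using this
  · intro h1
    have := ht ((1, 0), (0, 0))
    rw [h1] at this
    simp [Me] at this
  · rw [mem_fix, ht]
    simp [Me]
    linarith
  · rw [mem_fix, ht]
    simp [Me]
    linarith
  · simp [hypB]; ring
  · simp [hypB]; ring
  · simp [hypB]
  · apply le_antisymm
    · rw [Submodule.span_le]
      rintro x (rfl | rfl)
      · change _ ∈ fixLat t
        rw [mem_fix, ht]
        simp [Me]
        linarith
      · change _ ∈ fixLat t
        rw [mem_fix, ht]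
        simp [Me]
        linarith
    · rintro ⟨⟨a, b⟩, ⟨c, d⟩⟩ hx
      rw [mem_fix, ht] at hx
      simp only [Me, Prod.mk.injEq] at hx
      obtain ⟨⟨e1, e2⟩, ⟨e3, e4⟩⟩ := hx
      rw [Submodule.mem_span_pair]
      refine ⟨c, -ε * d, ?_⟩
      rcases h with rfl | rfl <;> simp <;> omega

lemma exists0 : ∃ t : HypSum ≃ₗ[ℤ] HypSum, (∀ x, t x = M0 x) ∧ IsIsom t ∧ t ^ 3 = 1 ∧
    t ≠ 1 ∧ fixLat t = ⊥ := by
  have hc : ∀ x, M0 (M0 (M0 x)) = x := by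
    rintro ⟨⟨a, b⟩, ⟨c, d⟩⟩
    simp only [M0, Prod.mk.injEq]
    refine ⟨⟨?_, ?_⟩, ⟨?_, ?_⟩⟩ <;> first | trivial | ring
  obtain ⟨t, ht⟩ := exists_equiv M0 (fun x => M0 (M0 x))
    (by rintro ⟨⟨a, b⟩, ⟨c, d⟩⟩ ⟨⟨a', b'⟩, ⟨c', d'⟩⟩
        simp only [M0, Prod.mk_add_mk, Prod.mk.injEq]
        refine ⟨⟨?_, ?_⟩, ⟨?_, ?_⟩⟩ <;> first | trivial | ring)
    (by rintro k ⟨⟨a, b⟩, ⟨c, d⟩⟩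
        simp only [M0, Prod.smul_mk, Prod.mk.injEq, smul_eq_mul]
        refine ⟨⟨?_, ?_⟩, ⟨?_, ?_⟩⟩ <;> first | trivial | ring) hc hc
  refine ⟨t, ht, ?_, ?_, ?_, ?_⟩
  · rintro ⟨⟨a, b⟩, ⟨c, d⟩⟩ ⟨⟨a', b'⟩, ⟨c', d'⟩⟩
    rw [ht, ht]
    simp only [M0, hypB]
    ring
  · ext1 x
    have : t (t (t x)) = x := by rw [ht, ht, ht, hc]
    simpa [pow_succ] using this
  · intro h1
    have := ht ((1, 0), (0, 0))
    rw [h1] at this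
    simp [M0] at this
  · rw [Submodule.eq_bot_iff]
    rintro ⟨⟨a, b⟩, ⟨c, d⟩⟩ hx
    rw [mem_fix, ht] at hx
    simp only [M0, Prod.mk.injEq] at hx
    obtain ⟨⟨e1, e2⟩, ⟨e3, e4⟩⟩ := hx
    simp only [Prod.mk_eq_zero]
    refine ⟨⟨?_, ?_⟩, ⟨?_, ?_⟩⟩ <;> omega

lemma exists_s (k : ℤ) : ∃ s : HypSum ≃ₗ[ℤ] HypSum,
    (∀ x, s x = ((x.1.1 - x.2.1 - k * (x.1.2 + x.2.2), x.1.2),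
      (-x.2.1 - k * x.1.2, -x.1.2 - x.2.2))) ∧ IsIsom s ∧ s ^ 2 = 1 ∧
    ∀ t : HypSum ≃ₗ[ℤ] HypSum, (∀ x, t x = M0 x) → s * t * s = t⁻¹ := by
  let f : HypSum → HypSum := fun x => ((x.1.1 - x.2.1 - k * (x.1.2 + x.2.2), x.1.2),
      (-x.2.1 - k * x.1.2, -x.1.2 - x.2.2))
  have hc : ∀ x, f (f x) = x := by
    rintro ⟨⟨a, b⟩, ⟨c, d⟩⟩
    simp only [f, Prod.mk.injEq]
    refine ⟨⟨?_, ?_⟩, ⟨?_, ?_⟩⟩ <;> first | trivial | ring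
  obtain ⟨s, hs⟩ := exists_equiv f f
    (by rintro ⟨⟨a, b⟩, ⟨c, d⟩⟩ ⟨⟨a', b'⟩, ⟨c', d'⟩⟩
        simp only [f, Prod.mk_add_mk, Prod.mk.injEq]
        refine ⟨⟨?_, ?_⟩, ⟨?_, ?_⟩⟩ <;> first | trivial | ring)
    (by rintro k ⟨⟨a, b⟩, ⟨c, d⟩⟩
        simp only [f, Prod.smul_mk, Prod.mk.injEq, smul_eq_mul]
        refine ⟨⟨?_, ?_⟩, ⟨?_, ?_⟩⟩ <;> first | trivial | ring) hc hc
  refine ⟨s, hs, ?_, ?_, ?_⟩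
  · rintro ⟨⟨a, b⟩, ⟨c, d⟩⟩ ⟨⟨a', b'⟩, ⟨c', d'⟩⟩
    rw [hs, hs]
    simp only [f, hypB]
    ring
  · ext1 x
    have : s (s x) = x := by rw [hs, hs, hc]
    simpa [pow_succ] using this
  · intro t ht
    rw [eq_inv_iff_mul_eq_one]
    ext1 x
    have : s (t (s (t x))) = x := by
      rw [ht, hs, ht, hs]
      obtain ⟨⟨a, b⟩, ⟨c, d⟩⟩ := x
      simp only [f, M0, Prod.mk.injEq]
      refine ⟨⟨?_, ?_⟩, ⟨?_, ?_⟩⟩ <;> first | trivial | ring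
    simpa using this

lemma gram_s0 (s : HypSum ≃ₗ[ℤ] HypSum)
    (hs : ∀ x, s x = ((x.1.1 - x.2.1 - 0 * (x.1.2 + x.2.2), x.1.2),
      (-x.2.1 - 0 * x.1.2, -x.1.2 - x.2.2))) : HasGram (fixLat s) 0 0 2 := by
  have hu : (((1, 0), (0, 0)) : HypSum) ∈ fixLat s := by rw [mem_fix, hs]; simp
  have hv : (((0, 2), (0, -1)) : HypSum) ∈ fixLat s := by rw [mem_fix, hs]; simp
  refine ⟨_, _, hu, hv, by simp [hypB], by simp [hypB], by simp [hypB], le_antisymm ?_ ?_⟩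
  · rw [Submodule.span_le]
    rintro x (rfl | rfl)
    exacts [hu, hv]
  · rintro ⟨⟨a, b⟩, ⟨c, d⟩⟩ hx
    rw [mem_fix, hs] at hx
    simp only [Prod.mk.injEq] at hx
    obtain ⟨⟨e1, e2⟩, ⟨e3, e4⟩⟩ := hx
    rw [Submodule.mem_span_pair]
    refine ⟨a, -d, ?_⟩
    simp
    refine ⟨?_, ?_⟩ <;> linarith

lemma gram_s1 (s : HypSum ≃ₗ[ℤ] HypSum)
    (hs : ∀ x, s x = ((x.1.1 - x.2.1 - 1 * (x.1.2 + x.2.2), x.1.2),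
      (-x.2.1 - 1 * x.1.2, -x.1.2 - x.2.2))) : HasGram (fixLat s) 2 (-2) 0 := by
  have hu : (((0, -2), (1, 1)) : HypSum) ∈ fixLat s := by rw [mem_fix, hs]; simp
  have hv : (((1, -2), (1, 1)) : HypSum) ∈ fixLat s := by rw [mem_fix, hs]; simp
  refine ⟨_, _, hu, hv, by simp [hypB], by simp [hypB], by simp [hypB], le_antisymm ?_ ?_⟩
  · rw [Submodule.span_le]
    rintro x (rfl | rfl)
    exacts [hu, hv]
  · rintro ⟨⟨a, b⟩, ⟨c, d⟩⟩ hx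
    rw [mem_fix, hs] at hx
    simp only [Prod.mk.injEq] at hx
    obtain ⟨⟨e1, e2⟩, ⟨e3, e4⟩⟩ := hx
    rw [Submodule.mem_span_pair]
    refine ⟨c - a, a, ?_⟩
    simp
    refine ⟨?_, ?_⟩ <;> linarith


end H13

/-- classification of order-3 isometries of `P = U ⊕ U` by their fixed
lattices (`A₂`, `A₂(−1)` or `0`), conjugacy of the generated subgroups, and the fixed
lattices (`U(2)` or `⟨2⟩ ⊕ ⟨−2⟩`) of involutions `s` inverting an order-3 isometry `t`
with trivial fixed lattice. -/
theorem stmt_13 :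
    -- (i)
    (∀ t : HypSum ≃ₗ[ℤ] HypSum, IsIsom t → t ^ 3 = 1 → t ≠ 1 →
      ((HasGram (fixLat t) (-2) (-2) 1 ∨ HasGram (fixLat t) 2 2 (-1) ∨ fixLat t = ⊥) ∧
        ¬(HasGram (fixLat t) (-2) (-2) 1 ∧ HasGram (fixLat t) 2 2 (-1)) ∧
        ¬(HasGram (fixLat t) (-2) (-2) 1 ∧ fixLat t = ⊥) ∧
        ¬(HasGram (fixLat t) 2 2 (-1) ∧ fixLat t = ⊥))) ∧
    -- (i) continued: all three cases occur
    (∃ t : HypSum ≃ₗ[ℤ] HypSum, IsIsom t ∧ t ^ 3 = 1 ∧ t ≠ 1 ∧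
      HasGram (fixLat t) (-2) (-2) 1) ∧
    (∃ t : HypSum ≃ₗ[ℤ] HypSum, IsIsom t ∧ t ^ 3 = 1 ∧ t ≠ 1 ∧
      HasGram (fixLat t) 2 2 (-1)) ∧
    (∃ t : HypSum ≃ₗ[ℤ] HypSum, IsIsom t ∧ t ^ 3 = 1 ∧ t ≠ 1 ∧ fixLat t = ⊥) ∧
    -- (ii)
    (∀ t t' : HypSum ≃ₗ[ℤ] HypSum, IsIsom t → t ^ 3 = 1 → t ≠ 1 →
      IsIsom t' → t' ^ 3 = 1 → t' ≠ 1 →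
      (∃ e : fixLat t ≃ₗ[ℤ] fixLat t',
        ∀ x y : fixLat t, hypB (e x : HypSum) (e y : HypSum) = hypB (x : HypSum) (y : HypSum)) →
      ∃ a : HypSum ≃ₗ[ℤ] HypSum, IsIsom a ∧
        (Subgroup.zpowers t).map (MulAut.conj a).toMonoidHom = Subgroup.zpowers t') ∧
    -- (iii)
    (∀ t s : HypSum ≃ₗ[ℤ] HypSum, IsIsom t → t ^ 3 = 1 → t ≠ 1 → fixLat t = ⊥ →
      IsIsom s → s ^ 2 = 1 → s * t * s = t⁻¹ →
      (HasGram (fixLat s) 0 0 2 ∨ HasGram (fixLat s) 2 (-2) 0)) ∧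
    -- (iii) continued: both cases occur
    (∃ t s : HypSum ≃ₗ[ℤ] HypSum, IsIsom t ∧ t ^ 3 = 1 ∧ t ≠ 1 ∧ fixLat t = ⊥ ∧
      IsIsom s ∧ s ^ 2 = 1 ∧ s * t * s = t⁻¹ ∧ HasGram (fixLat s) 0 0 2) ∧
    (∃ t s : HypSum ≃ₗ[ℤ] HypSum, IsIsom t ∧ t ^ 3 = 1 ∧ t ≠ 1 ∧ fixLat t = ⊥ ∧
      IsIsom s ∧ s ^ 2 = 1 ∧ s * t * s = t⁻¹ ∧ HasGram (fixLat s) 2 (-2) 0) := by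
  refine ⟨H13.part1, ?_, ?_, ?_, H13.part2, ?_, ?_, ?_⟩
  · simpa using H13.existsF 1 (Or.inl rfl)
  · simpa using H13.existsF (-1) (Or.inr rfl)
  · obtain ⟨t, -, h⟩ := H13.exists0
    exact ⟨t, h⟩
  · intro t s ht h3 _ hF hs h2 hst
    have c := H13.cube_of h3
    have d := H13.sq_of h2
    exact H13.part3 t s c (H13.zero_of_bot c hF) ht hs d (H13.inv_of c d hst)
  · obtain ⟨t, hM, h1, h2, h3, h4⟩ := H13.exists0
    obtain ⟨s, hs, i1, i2, i3⟩ := H13.exists_s 0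
    exact ⟨t, s, h1, h2, h3, h4, i1, i2, i3 t hM, H13.gram_s0 s hs⟩
  · obtain ⟨t, hM, h1, h2, h3, h4⟩ := H13.exists0
    obtain ⟨s, hs, i1, i2, i3⟩ := H13.exists_s 1
    exact ⟨t, s, h1, h2, h3, h4, i1, i2, i3 t hM, H13.gram_s1 s hs⟩
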